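/- arXiv:2308.07725 — 13 statements merged into one kernel-verified Lean document; each statement's English description precedes it below -/
import Mathlib

section
/- Let X be a metric space, L ≥ 0, and let γ : [0,1] → K(X) be L-Lipschitz with respect to the Hausdorff distance. Then for every a ∈ γ(0) there exist b ∈ γ(1) and an L-Lipschitz map c : [0,1] → X such that c(0) = a, c(1) = b, and c(t) ∈ γ(t) for every t ∈ [0,1]. -/
open TopologicalSpace unitInterval

theorem exists_near_point_aux {X : Type*} [MetricSpace X] (A B : NonemptyCompacts X) (r : ℝ)
    (h : dist A B ≤ r) (x : X) (hx : x ∈ (A : Set X)) : ∃ y ∈ (B : Set X), dist x y ≤ r := by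
  obtain ⟨y, hy, hxy⟩ := B.isCompact.exists_infDist_eq_dist B.nonempty x
  refine ⟨y, hy, ?_⟩
  rw [← hxy]
  refine le_trans ?_ h
  rw [Metric.NonemptyCompacts.dist_eq]
  exact Metric.infDist_le_hausdorffDist_of_mem hx
    (Metric.hausdorffEDist_ne_top_of_nonempty_of_bounded A.nonempty B.nonempty
      A.isCompact.isBounded B.isCompact.isBounded)

theorem finite_selection_aux {X : Type*} [MetricSpace X]
    (L : ℝ) (γ : unitInterval → NonemptyCompacts X)
    (hγ : ∀ s t : unitInterval, dist (γ s) (γ t) ≤ L * dist s t)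
    (a : X) (ha : a ∈ (γ 0 : Set X)) (F : Finset unitInterval) :
    ∃ c : unitInterval → X, (∀ t, c t ∈ (γ t : Set X)) ∧ c 0 = a ∧
      ∀ s ∈ insert 0 F, ∀ t ∈ insert 0 F, s ≤ t → dist (c s) (c t) ≤ L * ((t : ℝ) - s) := by
  classical
  induction F using Finset.induction_on_max with
  | empty =>
    choose c hc using fun t => (γ t).nonempty
    refine ⟨Function.update c 0 a, ?_, by simp, ?_⟩
    · intro t
      by_cases h : t = 0
      · subst h; simpa using ha
      · simpa [h] using hc t
    · intro s hs t ht _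
      simp at hs ht
      subst hs; subst ht; simp
  | insert x F hx ih =>
    obtain ⟨c, hc, h0, hl⟩ := ih
    by_cases hxF : x ∈ insert 0 F
    · refine ⟨c, hc, h0, ?_⟩
      have : insert 0 (insert x F) = insert 0 F := by
        rw [Finset.insert_comm, Finset.insert_eq_self.2 hxF]
      rw [this]; exact hl
    · have hx0 : x ≠ 0 := fun h => hxF (by simp [h])
      have hlt : ∀ y ∈ insert 0 F, y < x := by
        intro y hy
        rcases Finset.mem_insert.1 hy with h | h
        · subst h; exact lt_of_le_of_ne unitInterval.nonneg' hx0.symm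
        · exact hx y h
      have hne : (insert 0 F).Nonempty := ⟨0, by simp⟩
      obtain ⟨m, hm, hmax⟩ : ∃ m ∈ insert 0 F, ∀ y ∈ insert 0 F, y ≤ m :=
        ⟨_, Finset.max'_mem _ hne, fun y hy => Finset.le_max' _ y hy⟩
      obtain ⟨y, hy, hd⟩ := exists_near_point_aux _ _ _ (hγ m x) (c m) (hc m)
      have hmx : dist m x = (x : ℝ) - m := by
        have : (m : ℝ) < x := hlt m hm
        rw [Subtype.dist_eq, dist_comm, Real.dist_eq, abs_of_pos (by linarith)]
      rw [hmx] at hd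
      refine ⟨Function.update c x y, ?_, by simp [hx0.symm, h0], ?_⟩
      · intro t
        by_cases h : t = x
        · subst h; simpa using hy
        · simpa [h] using hc t
      · intro s hs t ht hst
        rw [Finset.insert_comm, Finset.mem_insert] at hs ht
        rcases hs with rfl | hs <;> rcases ht with rfl | ht
        · simp
        · exact absurd (hlt t ht) (not_lt.2 hst)
        · rw [Function.update_of_ne (hlt s hs).ne, Function.update_self]
          have := hl s hs m hm (hmax s hs)
          have := dist_triangle (c s) (c m) y
          linarith
        · rw [Function.update_of_ne (hlt s hs).ne, Function.update_of_ne (hlt t ht).ne]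
          exact hl s hs t ht hst

/-- Components of a Lipschitz path in `K(X)`: if `γ : [0,1] → K(X)` is `L`-Lipschitz with respect
to the Hausdorff distance, then every `a ∈ γ(0)` is connected to some `b ∈ γ(1)` by an
`L`-Lipschitz path `c : [0,1] → X` with `c(t) ∈ γ(t)` for all `t`. -/
theorem exists_lipschitz_selection_through_start {X : Type*} [MetricSpace X]
    (L : ℝ) (hL : 0 ≤ L) (γ : unitInterval → NonemptyCompacts X)
    (hγ : ∀ s t : unitInterval, dist (γ s) (γ t) ≤ L * dist s t) :
    ∀ a ∈ (γ 0 : Set X), ∃ b ∈ (γ 1 : Set X), ∃ c : unitInterval → X,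
      (∀ s t : unitInterval, dist (c s) (c t) ≤ L * dist s t) ∧
      c 0 = a ∧ c 1 = b ∧ ∀ t : unitInterval, c t ∈ (γ t : Set X) := by
  classical
  intro a ha
  have hK : IsCompact (Set.univ.pi (fun t => (γ t : Set X)) ∩ {c | c 0 = a}) :=
    (isCompact_univ_pi fun t => (γ t).isCompact).inter_right
      (isClosed_eq (continuous_apply 0) continuous_const)
  obtain ⟨c, ⟨hc, h0⟩, hl⟩ := hK.inter_iInter_nonempty
    (fun p : unitInterval × unitInterval =>
      {c : unitInterval → X | dist (c p.1) (c p.2) ≤ L * dist p.1 p.2})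
    (fun p => isClosed_le ((continuous_apply p.1).dist (continuous_apply p.2)) continuous_const)
    (by
      intro u
      obtain ⟨c, hc, h0, hl⟩ := finite_selection_aux L γ hγ a ha
        (u.image Prod.fst ∪ u.image Prod.snd)
      refine ⟨c, ⟨fun t _ => hc t, h0⟩, ?_⟩
      simp only [Set.mem_iInter, Set.mem_ofPred_eq]
      intro p hp
      have h1 : p.1 ∈ insert 0 (u.image Prod.fst ∪ u.image Prod.snd) :=
        Finset.mem_insert_of_mem (Finset.mem_union_left _ (Finset.mem_image_of_mem _ hp))
      have h2 : p.2 ∈ insert 0 (u.image Prod.fst ∪ u.image Prod.snd) :=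
        Finset.mem_insert_of_mem (Finset.mem_union_right _ (Finset.mem_image_of_mem _ hp))
      rcases le_total p.1 p.2 with h | h
      · refine (hl _ h1 _ h2 h).trans (mul_le_mul_of_nonneg_left ?_ hL)
        rw [dist_comm, Subtype.dist_eq, Real.dist_eq]
        exact le_abs_self _
      · rw [dist_comm]
        refine (hl _ h2 _ h1 h).trans (mul_le_mul_of_nonneg_left ?_ hL)
        rw [Subtype.dist_eq, Real.dist_eq]
        exact le_abs_self _)
  simp only [Set.mem_iInter, Set.mem_ofPred_eq] at hl
  exact ⟨c 1, hc 1 trivial, c, fun s t => hl (s, t), h0, rfl, fun t => hc t trivial⟩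
end

section
/- Let X be a metric space, L ≥ 0, and let γ : [0,1] → K(X) be L-Lipschitz with respect to the Hausdorff distance. Call an L-Lipschitz map c : [0,1] → X with c(t) ∈ γ(t) for all t ∈ [0,1] an L-Lipschitz selection of γ. Then for every s ∈ [0,1] and every x ∈ γ(s) there exists an L-Lipschitz selection c of γ with c(s) = x. Consequently, for every t ∈ [0,1], γ(t) = {c(t) : c an L-Lipschitz selection of γ}, and the endpoint relation R = {(c(0), c(1)) : c an L-Lipschitz selection of γ} ⊆ γ(0) × γ(1) is complete (every point of γ(0) occurs as a first coordinate and every point of γ(1) as a second coordinate). -/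
open TopologicalSpace unitInterval

/-- `c` is an `L`-Lipschitz selection of the set-valued path `γ : [0,1] → K(X)`: it is an
`L`-Lipschitz map with `c(t) ∈ γ(t)` for all `t`. -/
def IsLipSelection {X : Type*} [MetricSpace X] (L : ℝ)
    (γ : unitInterval → NonemptyCompacts X) (c : unitInterval → X) : Prop :=
  (∀ s t : unitInterval, dist (c s) (c t) ≤ L * dist s t) ∧
    ∀ t : unitInterval, c t ∈ (γ t : Set X)

/-- Nearest points in `γ t` realise the Lipschitz bound. -/
lemma exists_step {X : Type*} [MetricSpace X] (L : ℝ) (γ : unitInterval → NonemptyCompacts X)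
    (hγ : ∀ s t : unitInterval, dist (γ s) (γ t) ≤ L * dist s t) (s t : unitInterval)
    (x : X) (hx : x ∈ (γ s : Set X)) : ∃ y ∈ (γ t : Set X), dist x y ≤ L * dist s t := by
  obtain ⟨y, hy, hxy⟩ := (γ t).isCompact.exists_infDist_eq_dist (γ t).nonempty x
  refine ⟨y, hy, ?_⟩
  rw [← hxy]
  refine le_trans ?_ (hγ s t)
  rw [Metric.NonemptyCompacts.dist_eq]
  exact Metric.infDist_le_hausdorffDist_of_mem hx
    (Metric.hausdorffEDist_ne_top_of_nonempty_of_bounded (γ s).nonempty (γ t).nonempty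
      (γ s).isCompact.isBounded (γ t).isCompact.isBounded)

/-- If `a` is at least as far from `s` as all points of `F`, some point of `F ∪ {s}` lies
between `a` and every point of `F ∪ {s}`. -/
lemma exists_between_point (s a : unitInterval) (F : Finset unitInterval)
    (hF : ∀ t ∈ F, dist t s ≤ dist a s) :
    ∃ m ∈ insert s F, ∀ t ∈ insert s F, dist t m + dist m a = dist t a := by
  have hF' : ∀ t ∈ insert s F, dist t s ≤ dist a s := by
    intro t ht
    rcases Finset.mem_insert.1 ht with rfl | ht
    · simp
    · exact hF t ht
  have hne : (insert s F).Nonempty := ⟨s, Finset.mem_insert_self _ _⟩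
  rcases le_total s a with hsa | hsa
  · obtain ⟨m, hm, hmax⟩ := (insert s F).exists_max_image id hne
    have key : ∀ t ∈ insert s F, (t : ℝ) ≤ a := by
      intro t ht
      have h := hF' t ht
      have h1 : (s : ℝ) ≤ a := hsa
      rw [Subtype.dist_eq, Subtype.dist_eq, Real.dist_eq, Real.dist_eq,
        abs_of_nonneg (sub_nonneg.2 h1)] at h
      linarith [le_abs_self ((t : ℝ) - s)]
    refine ⟨m, hm, fun t ht => ?_⟩
    have h1 : (t : ℝ) ≤ m := hmax t ht
    have h2 := key m hm
    have h3 := key t ht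
    simp only [Subtype.dist_eq, Real.dist_eq]
    rw [abs_of_nonpos (by linarith), abs_of_nonpos (by linarith), abs_of_nonpos (by linarith)]
    ring
  · obtain ⟨m, hm, hmin⟩ := (insert s F).exists_min_image id hne
    have key : ∀ t ∈ insert s F, (a : ℝ) ≤ t := by
      intro t ht
      have h := hF' t ht
      have h1 : (a : ℝ) ≤ s := hsa
      rw [Subtype.dist_eq, Subtype.dist_eq, Real.dist_eq, Real.dist_eq,
        abs_of_nonpos (sub_nonpos.2 h1)] at h
      linarith [neg_abs_le ((t : ℝ) - s)]
    refine ⟨m, hm, fun t ht => ?_⟩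
    have h1 : (m : ℝ) ≤ t := hmin t ht
    have h2 := key m hm
    have h3 := key t ht
    simp only [Subtype.dist_eq, Real.dist_eq]
    rw [abs_of_nonneg (by linarith), abs_of_nonneg (by linarith), abs_of_nonneg (by linarith)]
    ring

/-- Selections that are Lipschitz on a finite set. -/
lemma exists_finite_selection {X : Type*} [MetricSpace X] (L : ℝ)
    (γ : unitInterval → NonemptyCompacts X)
    (hγ : ∀ s t : unitInterval, dist (γ s) (γ t) ≤ L * dist s t) (s : unitInterval)
    (x : X) (hx : x ∈ (γ s : Set X)) (F : Finset unitInterval) :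
    ∃ c : unitInterval → X, (∀ t, c t ∈ (γ t : Set X)) ∧ c s = x ∧
      ∀ t ∈ insert s F, ∀ u ∈ insert s F, dist (c t) (c u) ≤ L * dist t u := by
  induction F using Finset.induction_on_max_value (fun t => dist t s) with
  | empty =>
    choose c hc using fun t => (γ t).nonempty
    refine ⟨Function.update c s x, fun t => ?_, by simp, by simp⟩
    by_cases h : t = s
    · subst h; simpa using hx
    · simpa [Function.update_of_ne h] using hc t
  | insert a F haF hmax ih =>
    obtain ⟨c, hc, hcs, hlip⟩ := ih
    by_cases has : a = s
    · subst has
      exact ⟨c, hc, hcs, by simpa using hlip⟩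
    obtain ⟨m, hm, hbet⟩ := exists_between_point s a F hmax
    obtain ⟨y, hy, hmy⟩ := exists_step L γ hγ m a (c m) (hc m)
    have hy' : ∀ t ∈ insert s F, dist (c t) y ≤ L * dist t a := by
      intro t ht
      calc dist (c t) y ≤ dist (c t) (c m) + dist (c m) y := dist_triangle _ _ _
        _ ≤ L * dist t m + L * dist m a := add_le_add (hlip t ht m hm) hmy
        _ = L * dist t a := by rw [← mul_add, hbet t ht]
    refine ⟨Function.update c a y, fun t => ?_, ?_, ?_⟩
    · by_cases h : t = a
      · subst h; simpa using hy
      · simpa [Function.update_of_ne h] using hc t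
    · rw [Function.update_of_ne (Ne.symm has), hcs]
    · intro t ht u hu
      rw [Finset.insert_comm, Finset.mem_insert] at ht hu
      by_cases h1 : t = a
      · by_cases h2 : u = a
        · simp [h1, h2]
        · rw [h1, Function.update_self, Function.update_of_ne h2, dist_comm, dist_comm a]
          exact hy' u (hu.resolve_left h2)
      · by_cases h2 : u = a
        · rw [h2, Function.update_self, Function.update_of_ne h1]
          exact hy' t (ht.resolve_left h1)
        · rw [Function.update_of_ne h1, Function.update_of_ne h2]
          exact hlip t (ht.resolve_left h1) u (hu.resolve_left h2)

/-- Selections through a prescribed point, by Tychonoff compactness. -/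
lemma exists_selection {X : Type*} [MetricSpace X] (L : ℝ)
    (γ : unitInterval → NonemptyCompacts X)
    (hγ : ∀ s t : unitInterval, dist (γ s) (γ t) ≤ L * dist s t) (s : unitInterval)
    (x : X) (hx : x ∈ (γ s : Set X)) :
    ∃ c : unitInterval → X, IsLipSelection L γ c ∧ c s = x := by
  have hK : IsCompact (Set.univ.pi fun t => (γ t : Set X)) :=
    isCompact_univ_pi fun t => (γ t).isCompact
  obtain ⟨c, hc, hc'⟩ := hK.inter_iInter_nonempty
    (fun p : unitInterval × unitInterval =>
      {c : unitInterval → X | dist (c p.1) (c p.2) ≤ L * dist p.1 p.2} ∩ {c | c s = x})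
    (fun p => (isClosed_le (by fun_prop) (by fun_prop)).inter
      (isClosed_eq (by fun_prop) (by fun_prop)))
    (fun u => by
      classical
      obtain ⟨c, hc, hcs, hlip⟩ := exists_finite_selection L γ hγ s x hx
        (u.image Prod.fst ∪ u.image Prod.snd)
      refine ⟨c, fun t _ => hc t, Set.mem_iInter₂.2 fun p hp => ⟨hlip _ ?_ _ ?_, hcs⟩⟩
      · exact Finset.mem_insert_of_mem
          (Finset.mem_union_left _ (Finset.mem_image_of_mem _ hp))
      · exact Finset.mem_insert_of_mem
          (Finset.mem_union_right _ (Finset.mem_image_of_mem _ hp)))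
  rw [Set.mem_iInter] at hc'
  exact ⟨c, ⟨fun a b => (hc' (a, b)).1, fun t => hc t trivial⟩, (hc' (s, s)).2⟩

/-- If `γ : [0,1] → K(X)` is `L`-Lipschitz for the Hausdorff distance, then through every point
`x ∈ γ(s)` there passes an `L`-Lipschitz selection of `γ`; consequently each `γ(t)` is exactly the
set of values at `t` of the `L`-Lipschitz selections, and the endpoint relation
`{(c(0), c(1)) : c a selection} ⊆ γ(0) × γ(1)` is complete. -/
theorem lipschitz_selections_represent {X : Type*} [MetricSpace X]
    (L : ℝ) (hL : 0 ≤ L) (γ : unitInterval → NonemptyCompacts X)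
    (hγ : ∀ s t : unitInterval, dist (γ s) (γ t) ≤ L * dist s t) :
    (∀ s : unitInterval, ∀ x ∈ (γ s : Set X),
      ∃ c : unitInterval → X, IsLipSelection L γ c ∧ c s = x) ∧
    (∀ t : unitInterval,
      (γ t : Set X) = {p | ∃ c : unitInterval → X, IsLipSelection L γ c ∧ c t = p}) ∧
    (∀ a ∈ (γ 0 : Set X), ∃ c : unitInterval → X, IsLipSelection L γ c ∧ c 0 = a) ∧
    (∀ b ∈ (γ 1 : Set X), ∃ c : unitInterval → X, IsLipSelection L γ c ∧ c 1 = b) := by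
  have H := exists_selection L γ hγ
  refine ⟨H, fun t => Set.ext fun p => ⟨H t p, ?_⟩, H 0, H 1⟩
  rintro ⟨c, hc, rfl⟩
  exact hc.2 t
end

section
/- Let σ ≥ 1, λ > 1, and let X be a σ-quasiconvex metric space. Then for any two nonempty bounded closed subsets A, B ⊆ X there is a map γ : [0,1] → Set X such that γ(0) = A, γ(1) = B, every γ(t) is a nonempty bounded closed subset of X, and d_H(γ(s), γ(t)) ≤ σλ·d_H(A,B)·|s−t| for all s,t ∈ [0,1]. (That is, the hyperspace BCl(X) of nonempty bounded closed subsets of X with the Hausdorff distance is σλ-quasiconvex.) -/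
open unitInterval

/-- A metric space `X` is `λ`-quasiconvex if every two points are joined by a continuous path
`γ : [0,1] → X` that is `λ·d(x,y)`-Lipschitz. -/
def QuasiconvexSpace (X : Type*) [MetricSpace X] (lam : ℝ) : Prop :=
  ∀ x y : X, ∃ γ : unitInterval → X, Continuous γ ∧ γ 0 = x ∧ γ 1 = y ∧
    ∀ s t : unitInterval, dist (γ s) (γ t) ≤ lam * dist x y * dist s t

/-- If `X` is `σ`-quasiconvex with `σ ≥ 1` and `λ > 1`, then the hyperspace `BCl(X)` of nonempty
bounded closed subsets of `X` with the Hausdorff distance is `σλ`-quasiconvex: any two nonempty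
bounded closed sets `A, B` are joined by a `σλ·d_H(A,B)`-Lipschitz path through nonempty bounded
closed sets. -/
theorem quasiconvex_BCl {X : Type*} [MetricSpace X] (sigma lam : ℝ) (hsigma : 1 ≤ sigma) (hlam : 1 < lam)
    (hX : QuasiconvexSpace X sigma) (A B : Set X)
    (hAne : A.Nonempty) (hAbd : Bornology.IsBounded A) (hAcl : IsClosed A)
    (hBne : B.Nonempty) (hBbd : Bornology.IsBounded B) (hBcl : IsClosed B) :
    ∃ γ : unitInterval → Set X, γ 0 = A ∧ γ 1 = B ∧
      (∀ t : unitInterval, (γ t).Nonempty ∧ Bornology.IsBounded (γ t) ∧ IsClosed (γ t)) ∧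
      ∀ s t : unitInterval,
        Metric.hausdorffDist (γ s) (γ t) ≤ sigma * lam * Metric.hausdorffDist A B * dist s t := by
  have hfin : Metric.hausdorffEDist A B ≠ ⊤ :=
    Metric.hausdorffEDist_ne_top_of_nonempty_of_bounded hAne hBne hAbd hBbd
  have hD0 : 0 ≤ Metric.hausdorffDist A B := Metric.hausdorffDist_nonneg
  rcases hD0.eq_or_lt with h0 | hpos
  · have hAB : A = B := (hAcl.hausdorffDist_zero_iff_eq hBcl hfin).1 h0.symm
    subst hAB
    refine ⟨fun _ => A, rfl, rfl, fun _ => ⟨hAne, hAbd, hAcl⟩, fun s t => ?_⟩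
    simp [Metric.hausdorffDist_self_zero]
  generalize hD : Metric.hausdorffDist A B = D at *
  have hlt : D < lam * D := by nlinarith
  choose g hgc hg0 hg1 hgL using hX
  let P : Set (X × X) := {p | p.1 ∈ A ∧ p.2 ∈ B ∧ dist p.1 p.2 ≤ lam * D}
  have hA : ∀ a ∈ A, ∃ b, (a, b) ∈ P := by
    intro a ha
    obtain ⟨b, hb, h⟩ := Metric.exists_dist_lt_of_hausdorffDist_lt ha (hD.trans_lt hlt) hfin
    exact ⟨b, ha, hb, h.le⟩
  have hB : ∀ b ∈ B, ∃ a, (a, b) ∈ P := by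
    intro b hb
    obtain ⟨a, ha, h⟩ := Metric.exists_dist_lt_of_hausdorffDist_lt' hb (hD.trans_lt hlt) hfin
    exact ⟨a, ha, hb, h.le⟩
  have hC : 0 ≤ sigma * lam * D := by positivity
  have hL : ∀ p ∈ P, ∀ s t : unitInterval,
      dist (g p.1 p.2 s) (g p.1 p.2 t) ≤ sigma * lam * D * dist s t := by
    intro p hp s t
    refine (hgL p.1 p.2 s t).trans ?_
    rw [mul_assoc sigma lam D]
    have := hp.2.2
    gcongr
  let G : unitInterval → Set X := fun t => (fun p : X × X => g p.1 p.2 t) '' P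
  have hG0 : G 0 = A := by
    ext x
    constructor
    · rintro ⟨p, hp, rfl⟩
      simpa only [hg0] using hp.1
    · intro hx
      obtain ⟨b, hb⟩ := hA x hx
      exact ⟨(x, b), hb, hg0 _ _⟩
  have hG1 : G 1 = B := by
    ext x
    constructor
    · rintro ⟨p, hp, rfl⟩
      simpa only [hg1] using hp.2.1
    · intro hx
      obtain ⟨b, hb⟩ := hB x hx
      exact ⟨(b, x), hb, hg1 _ _⟩
  refine ⟨fun t => closure (G t), ?_, ?_, fun t => ⟨?_, ?_, isClosed_closure⟩, fun s t => ?_⟩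
  · simp only [hG0, hAcl.closure_eq]
  · simp only [hG1, hBcl.closure_eq]
  · obtain ⟨a, ha⟩ := hAne
    obtain ⟨b, hb⟩ := hA a ha
    exact Set.Nonempty.closure ⟨_, (a, b), hb, rfl⟩
  · refine Bornology.IsBounded.closure ?_
    refine (hAbd.cthickening (δ := sigma * lam * D * dist t 0)).subset ?_
    rintro _ ⟨p, hp, rfl⟩
    refine Metric.mem_cthickening_of_dist_le _ p.1 _ _ hp.1 ?_
    have := hL p hp t 0
    rwa [hg0] at this
  · simp only [Metric.hausdorffDist_closure]
    refine Metric.hausdorffDist_le_of_mem_dist (mul_nonneg hC dist_nonneg) ?_ ?_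
    · rintro _ ⟨p, hp, rfl⟩
      exact ⟨_, ⟨p, hp, rfl⟩, hL p hp s t⟩
    · rintro _ ⟨p, hp, rfl⟩
      refine ⟨_, ⟨p, hp, rfl⟩, ?_⟩
      rw [dist_comm s t]
      exact hL p hp t s
end

section
/- Let λ ≥ 1 and let X be a λ-quasiconvex metric space. Then for any two nonempty finite subsets A, B ⊆ X there is a map γ : [0,1] → Set X such that γ(0) = A, γ(1) = B, every γ(t) is a nonempty finite subset of X, and d_H(γ(s), γ(t)) ≤ λ·d_H(A,B)·|s−t| for all s,t ∈ [0,1]. (That is, the finite-subset space FS(X) with the Hausdorff distance is λ-quasiconvex; in particular, if X is geodesic then FS(X) is geodesic.) -/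
open unitInterval

/-- If `X` is `λ`-quasiconvex (`λ ≥ 1`), then the finite-subset space `FS(X)` with the Hausdorff
distance is `λ`-quasiconvex: any two nonempty finite subsets `A, B ⊆ X` are joined by a
`λ·d_H(A,B)`-Lipschitz path through nonempty finite subsets. -/
theorem quasiconvex_FS {X : Type*} [MetricSpace X] (lam : ℝ) (hlam : 1 ≤ lam)
    (hX : QuasiconvexSpace X lam) (A B : Set X)
    (hAne : A.Nonempty) (hAfin : A.Finite) (hBne : B.Nonempty) (hBfin : B.Finite) :
    ∃ γ : unitInterval → Set X, γ 0 = A ∧ γ 1 = B ∧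
      (∀ t : unitInterval, (γ t).Nonempty ∧ (γ t).Finite) ∧
      ∀ s t : unitInterval,
        Metric.hausdorffDist (γ s) (γ t) ≤ lam * Metric.hausdorffDist A B * dist s t := by
  classical
  have key : ∀ (A B : Set X), A.Nonempty → A.Finite → B.Nonempty → B.Finite → ∀ a ∈ A,
      ∃ b ∈ B, dist a b ≤ Metric.hausdorffDist A B := by
    intro A B hA hAf hB hBf a ha
    obtain ⟨b, hb, hab⟩ := hBf.isCompact.exists_infDist_eq_dist hB a
    refine ⟨b, hb, hab ▸ ?_⟩
    exact Metric.infDist_le_hausdorffDist_of_mem ha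
      (Metric.hausdorffEDist_ne_top_of_nonempty_of_bounded hA hB hAf.isBounded hBf.isBounded)
  choose g hgc hg0 hg1 hgL using hX
  let R : Set (X × X) :=
    {p | p.1 ∈ A ∧ p.2 ∈ B ∧ dist p.1 p.2 ≤ Metric.hausdorffDist A B}
  have hRA : ∀ a ∈ A, ∃ b, (a, b) ∈ R := fun a ha => by
    obtain ⟨b, hb, h⟩ := key A B hAne hAfin hBne hBfin a ha
    exact ⟨b, ha, hb, h⟩
  have hRB : ∀ b ∈ B, ∃ a, (a, b) ∈ R := fun b hb => by
    obtain ⟨a, ha, h⟩ := key B A hBne hBfin hAne hAfin b hb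
    refine ⟨a, ha, hb, ?_⟩
    rw [dist_comm, Metric.hausdorffDist_comm] at h
    exact h
  have hRfin : R.Finite := (hAfin.prod hBfin).subset fun p hp => ⟨hp.1, hp.2.1⟩
  have hRne : R.Nonempty := by
    obtain ⟨a, ha⟩ := hAne
    obtain ⟨b, hb⟩ := hRA a ha
    exact ⟨_, hb⟩
  have hd : ∀ p ∈ R, ∀ s t : unitInterval,
      dist (g p.1 p.2 s) (g p.1 p.2 t) ≤ lam * Metric.hausdorffDist A B * dist s t := by
    intro p hp s t
    refine (hgL p.1 p.2 s t).trans ?_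
    have := hp.2.2
    gcongr
  refine ⟨fun t => (fun p : X × X => g p.1 p.2 t) '' R, ?_, ?_, ?_, ?_⟩
  · ext x
    constructor
    · rintro ⟨p, hp, rfl⟩
      simpa only [hg0] using hp.1
    · intro hx
      obtain ⟨b, hb⟩ := hRA x hx
      exact ⟨_, hb, hg0 _ _⟩
  · ext x
    constructor
    · rintro ⟨p, hp, rfl⟩
      simpa only [hg1] using hp.2.1
    · intro hx
      obtain ⟨b, hb⟩ := hRB x hx
      exact ⟨_, hb, hg1 _ _⟩
  · exact fun t => ⟨hRne.image _, hRfin.image _⟩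
  · intro s t
    apply Metric.hausdorffDist_le_of_mem_dist
    · have := Metric.hausdorffDist_nonneg (s := A) (t := B)
      positivity
    · rintro _ ⟨p, hp, rfl⟩
      exact ⟨_, ⟨p, hp, rfl⟩, hd p hp s t⟩
    · rintro _ ⟨p, hp, rfl⟩
      refine ⟨_, ⟨p, hp, rfl⟩, ?_⟩
      rw [dist_comm s t]
      exact hd p hp t s
end

section
/- Let λ ≥ 1 and let X be a proper λ-quasiconvex metric space (every bounded closed subset of X is compact). Then the space K(X) of nonempty compact subsets of X with the Hausdorff metric is λ-quasiconvex: for all A, B ∈ K(X) there is a λ·d_H(A,B)-Lipschitz path γ : [0,1] → K(X) with γ(0) = A and γ(1) = B. -/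
open TopologicalSpace unitInterval

theorem exists_near_of_mem_K {X : Type*} [MetricSpace X] (A B : NonemptyCompacts X)
    {a : X} (ha : a ∈ (A : Set X)) : ∃ b ∈ (B : Set X), dist a b ≤ dist A B := by
  obtain ⟨b, hb, h⟩ := B.isCompact.exists_infDist_eq_dist B.nonempty a
  refine ⟨b, hb, ?_⟩
  rw [← h, Metric.NonemptyCompacts.dist_eq]
  exact Metric.infDist_le_hausdorffDist_of_mem ha
    (Metric.hausdorffEDist_ne_top_of_nonempty_of_bounded A.nonempty B.nonempty
      A.isCompact.isBounded B.isCompact.isBounded)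

/-- If `X` is a proper `λ`-quasiconvex metric space, then the space `K(X)` of nonempty compact
subsets of `X` with the Hausdorff metric is `λ`-quasiconvex: any `A, B ∈ K(X)` are joined by a
`λ·d_H(A,B)`-Lipschitz path in `K(X)`. -/
theorem quasiconvex_K_of_proper {X : Type*} [MetricSpace X] [ProperSpace X]
    (lam : ℝ) (hlam : 1 ≤ lam) (hX : QuasiconvexSpace X lam)
    (A B : NonemptyCompacts X) :
    ∃ γ : unitInterval → NonemptyCompacts X, γ 0 = A ∧ γ 1 = B ∧
      ∀ s t : unitInterval, dist (γ s) (γ t) ≤ lam * dist A B * dist s t := by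
  have hr : 0 ≤ lam * dist A B := mul_nonneg (by linarith) dist_nonneg
  let P : Set (unitInterval → X) := {p | p 0 ∈ (A : Set X) ∧ p 1 ∈ (B : Set X) ∧
    ∀ s t, dist (p s) (p t) ≤ lam * dist A B * dist s t}
  have key : ∀ a ∈ (A : Set X), ∀ b ∈ (B : Set X), dist a b ≤ dist A B →
      ∃ p ∈ P, p 0 = a ∧ p 1 = b := by
    intro a ha b hb hab
    obtain ⟨p, -, h0, h1, hp⟩ := hX a b
    refine ⟨p, ⟨h0 ▸ ha, h1 ▸ hb, fun s t => (hp s t).trans ?_⟩, h0, h1⟩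
    gcongr
  have e0 : (fun p : unitInterval → X => p 0) '' P = (A : Set X) := by
    apply Set.Subset.antisymm
    · rintro _ ⟨p, hp, rfl⟩
      exact hp.1
    · intro a ha
      obtain ⟨b, hb, hab⟩ := exists_near_of_mem_K A B ha
      obtain ⟨p, hp, h0, -⟩ := key a ha b hb hab
      exact ⟨p, hp, h0⟩
  have e1 : (fun p : unitInterval → X => p 1) '' P = (B : Set X) := by
    apply Set.Subset.antisymm
    · rintro _ ⟨p, hp, rfl⟩
      exact hp.2.1
    · intro b hb
      obtain ⟨a, ha, hab⟩ := exists_near_of_mem_K B A hb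
      obtain ⟨p, hp, -, h1⟩ := key a ha b hb (by rwa [dist_comm a b, dist_comm A B])
      exact ⟨p, hp, h1⟩
  have hPne : P.Nonempty := by
    have h := A.nonempty
    rw [← e0] at h
    exact h.of_image
  have hbd : ∀ t : unitInterval,
      Bornology.IsBounded ((fun p : unitInterval → X => p t) '' P) := by
    intro t
    refine (A.isCompact.isBounded.cthickening (δ := lam * dist A B * dist t 0)).subset ?_
    rintro _ ⟨p, hp, rfl⟩
    exact Metric.mem_cthickening_of_dist_le _ _ _ _ hp.1 (hp.2.2 t 0)
  let γ : unitInterval → NonemptyCompacts X := fun t =>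
    ⟨⟨closure ((fun p : unitInterval → X => p t) '' P), (hbd t).isCompact_closure⟩,
      (hPne.image _).closure⟩
  have hγ : ∀ t, (γ t : Set X) = closure ((fun p : unitInterval → X => p t) '' P) :=
    fun t => rfl
  refine ⟨γ, ?_, ?_, fun s t => ?_⟩
  · apply SetLike.coe_injective
    rw [hγ, e0, A.isCompact.isClosed.closure_eq]
  · apply SetLike.coe_injective
    rw [hγ, e1, B.isCompact.isClosed.closure_eq]
  · rw [Metric.NonemptyCompacts.dist_eq, hγ, hγ, Metric.hausdorffDist_closure]
    apply Metric.hausdorffDist_le_of_mem_dist (mul_nonneg hr dist_nonneg)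
    · rintro _ ⟨p, hp, rfl⟩
      exact ⟨p t, ⟨p, hp, rfl⟩, hp.2.2 s t⟩
    · rintro _ ⟨p, hp, rfl⟩
      exact ⟨p s, ⟨p, hp, rfl⟩, by rw [dist_comm]; exact hp.2.2 s t⟩
end

section
/- Let λ ≥ 1, c ≥ 0, let X be a λ-quasiconvex metric space and Y a metric space. If a map f : X → Y is locally c-Lipschitz, i.e. every x ∈ X has a radius r_x > 0 such that d(f(x), f(z)) ≤ c·d(x,z) for all z with d(x,z) < r_x, then f is (λc)-Lipschitz on all of X. -/
open unitInterval

/-- Gluing lemma: if `X` is a `λ`-quasiconvex metric space, `Y` a metric space, and `f : X → Y`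
is locally `c`-Lipschitz (each point has a radius `r > 0` on whose ball `f` is `c`-Lipschitz from
that point), then `f` is `λc`-Lipschitz on all of `X`. -/
theorem lipschitz_of_locally_lipschitz {X Y : Type*} [MetricSpace X] [MetricSpace Y]
    (lam c : ℝ) (hlam : 1 ≤ lam) (hc : 0 ≤ c) (hX : QuasiconvexSpace X lam) (f : X → Y)
    (hf : ∀ x : X, ∃ r > (0 : ℝ), ∀ z : X, dist x z < r → dist (f x) (f z) ≤ c * dist x z) :
    ∀ x x' : X, dist (f x) (f x') ≤ lam * c * dist x x' := by
  intro x x'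
  obtain ⟨γ, hγ, h0, h1, hL⟩ := hX x x'
  have hfc : Continuous f := by
    rw [continuous_iff_continuousAt]
    intro p
    obtain ⟨r, hr, h⟩ := hf p
    rw [Metric.continuousAt_iff]
    intro ε hε
    refine ⟨min r (ε / (c + 1)), by positivity, fun {z} hz => ?_⟩
    rw [dist_comm] at hz
    have hz1 := h z (lt_of_lt_of_le hz (min_le_left _ _))
    have hz2 := lt_of_lt_of_le hz (min_le_right _ _)
    rw [lt_div_iff₀ (by positivity)] at hz2
    rw [dist_comm]
    have : 0 ≤ dist p z := dist_nonneg
    linarith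
  let p : ℝ → X := fun t => γ (Set.projIcc 0 1 zero_le_one t)
  have hp : Continuous p := hγ.comp continuous_projIcc
  have hpL : ∀ s ∈ Set.Icc (0:ℝ) 1, ∀ t ∈ Set.Icc (0:ℝ) 1,
      dist (p s) (p t) ≤ lam * dist x x' * dist s t := by
    intro s hs t ht
    have := hL (Set.projIcc 0 1 zero_le_one s) (Set.projIcc 0 1 zero_le_one t)
    rw [Set.projIcc_of_mem zero_le_one hs, Set.projIcc_of_mem zero_le_one ht] at this
    simp only [p]
    rw [Set.projIcc_of_mem zero_le_one hs, Set.projIcc_of_mem zero_le_one ht]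
    exact this
  have hp0 : p 0 = x := by simp only [p, Set.projIcc_left]; exact h0
  have hp1 : p 1 = x' := by simp only [p, Set.projIcc_right]; exact h1
  have key : Set.Icc (0:ℝ) 1 ⊆ {t | dist (f x) (f (p t)) ≤ lam * c * dist x x' * t} := by
    apply IsClosed.Icc_subset_of_forall_exists_gt
    · refine IsClosed.inter (isClosed_le ?_ ?_) isClosed_Icc
      · exact continuous_const.dist (hfc.comp hp)
      · fun_prop
    · simp [hp0]
    · rintro s ⟨hs, hs0, hs1⟩ y hy
      obtain ⟨r, hr, h⟩ := hf (p s)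
      have e1 : ∀ᶠ t in nhdsWithin s (Set.Ioi s), dist (p s) (p t) < r := by
        apply Filter.Eventually.filter_mono nhdsWithin_le_nhds
        have hc2 : Continuous fun t => dist (p s) (p t) := continuous_const.dist hp
        exact hc2.continuousAt.eventually_lt continuousAt_const (by simpa using hr)
      have e2 : ∀ᶠ t in nhdsWithin s (Set.Ioi s), t ∈ Set.Ioo s (min y 1) :=
        Ioo_mem_nhdsGT (lt_min hy hs1)
      obtain ⟨t, ht1, ht2, ht3⟩ := (e1.and e2).exists
      have hty := lt_of_lt_of_le ht3 (min_le_left _ _)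
      have ht11 := lt_of_lt_of_le ht3 (min_le_right _ _)
      refine ⟨t, ?_, ht2, hty.le⟩
      have a1 := h _ ht1
      have a2 := hpL s ⟨hs0, hs1.le⟩ t ⟨hs0.trans ht2.le, ht11.le⟩
      have a3 : dist s t = t - s := by
        rw [dist_comm, Real.dist_eq, abs_of_pos (sub_pos.2 ht2)]
      rw [a3] at a2
      have a4 := mul_le_mul_of_nonneg_left a2 hc
      have a5 := dist_triangle (f x) (f (p s)) (f (p t))
      simp only [Set.mem_setOf_eq] at hs ⊢
      linarith
  have := key (Set.right_mem_Icc.2 zero_le_one)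
  simpa [hp1] using this
end

section
/- Let X be a metric space, n ≥ 1, L ≥ 0, and let x, y be nonempty finite subsets of X with |x| ≤ n and |y| ≤ n. Then the following are equivalent: (1) there exists a map γ : [0,1] → Set X with γ(0) = x, γ(1) = y, each γ(t) a nonempty finite subset of X with |γ(t)| ≤ n, and d_H(γ(s), γ(t)) ≤ L·|s−t| for all s,t ∈ [0,1]; (2) there exist a complete relation R ⊆ x × y and a family {c_{(a,b)} : [0,1] → X}_{(a,b)∈R} of L-Lipschitz maps with c_{(a,b)}(0) = a and c_{(a,b)}(1) = b, such that |{c_r(t) : r ∈ R}| ≤ n for every t ∈ [0,1]. -/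
open unitInterval

/-- One greedy step: a point of `γ s` has a partner in `γ t` at distance at most `L * dist s t`. -/
lemma fsn_step {X : Type*} [MetricSpace X] (L : ℝ) (γ : unitInterval → Set X)
    (hfin : ∀ t, (γ t).Finite) (hne : ∀ t, (γ t).Nonempty)
    (hlip : ∀ s t : unitInterval, Metric.hausdorffDist (γ s) (γ t) ≤ L * dist s t)
    (s t : unitInterval) (p : X) (hp : p ∈ γ s) : ∃ q ∈ γ t, dist p q ≤ L * dist s t := by
  obtain ⟨q, hq, h⟩ := (hfin t).isCompact.exists_infDist_eq_dist (hne t) p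
  refine ⟨q, hq, ?_⟩
  rw [← h]
  exact (Metric.infDist_le_hausdorffDist_of_mem hp
    (Metric.hausdorffEDist_ne_top_of_nonempty_of_bounded (hne s) (hne t)
      (hfin s).isBounded (hfin t).isBounded)).trans (hlip s t)

/-- Selections that are Lipschitz on a finite set of times. -/
lemma fsn_finite {X : Type*} [MetricSpace X] (L : ℝ) (γ : unitInterval → Set X)
    (hfin : ∀ t, (γ t).Finite) (hne : ∀ t, (γ t).Nonempty)
    (hlip : ∀ s t : unitInterval, Metric.hausdorffDist (γ s) (γ t) ≤ L * dist s t)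
    (a : X) (ha : a ∈ γ 0) (F : Finset unitInterval) :
    ∃ c : (t : unitInterval) → γ t, (c 0 : X) = a ∧
      ∀ s ∈ insert 0 F, ∀ t ∈ insert 0 F, dist (c s : X) (c t) ≤ L * dist s t := by
  classical
  induction F using Finset.induction_on_max with
  | empty =>
    let c0 : (t : unitInterval) → γ t := fun t => ⟨(hne t).some, (hne t).some_mem⟩
    refine ⟨Function.update c0 0 ⟨a, ha⟩, by simp, ?_⟩
    intro s hs t ht
    simp only [insert_empty_eq, Finset.mem_singleton] at hs ht
    subst hs ht
    simp
  | insert m' F hF ih =>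
    obtain ⟨c, hc0, hc⟩ := ih
    by_cases hm0 : m' = 0
    · subst hm0
      exact ⟨c, hc0, by simpa using hc⟩
    have hpos : (0 : unitInterval) < m' := unitInterval.pos_iff_ne_zero.mpr hm0
    set G := insert 0 F with hG
    have hGne : G.Nonempty := ⟨0, by simp [hG]⟩
    have hGlt : ∀ s ∈ G, s < m' := by
      intro s hs
      rcases Finset.mem_insert.1 hs with rfl | hs
      · exact hpos
      · exact hF s hs
    set m := G.max' hGne
    have hmG : m ∈ G := G.max'_mem hGne
    obtain ⟨q, hq, hd⟩ := fsn_step L γ hfin hne hlip m m' (c m) (c m).2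
    have key : ∀ s ∈ G, dist (c s : X) q ≤ L * dist s m' := by
      intro s hs
      have h1 : s ≤ m := G.le_max' s hs
      have h2 : m < m' := hGlt m hmG
      have e : dist s m' = dist s m + dist m m' := by
        have h1' : (s : ℝ) ≤ m := h1
        have h2' : (m : ℝ) < m' := h2
        simp only [Subtype.dist_eq, Real.dist_eq]
        rw [abs_of_nonpos (by linarith), abs_of_nonpos (by linarith), abs_of_nonpos (by linarith)]
        ring
      rw [e, mul_add]
      exact (dist_triangle _ _ _).trans (add_le_add (hc s hs m hmG) hd)
    refine ⟨Function.update c m' ⟨q, hq⟩, ?_, ?_⟩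
    · rw [Function.update_of_ne hpos.ne, hc0]
    · rw [Finset.insert_comm]
      intro s hs t ht
      rcases Finset.mem_insert.1 hs with rfl | hsG <;>
        rcases Finset.mem_insert.1 ht with rfl | htG
      · simp
      · rw [Function.update_self, Function.update_of_ne (hGlt t htG).ne, dist_comm, dist_comm s]
        exact key t htG
      · rw [Function.update_self, Function.update_of_ne (hGlt s hsG).ne]
        exact key s hsG
      · rw [Function.update_of_ne (hGlt s hsG).ne, Function.update_of_ne (hGlt t htG).ne]
        exact hc s hsG t htG

/-- A globally Lipschitz selection through a given initial point, by compactness. -/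
lemma fsn_selection {X : Type*} [MetricSpace X] (L : ℝ) (γ : unitInterval → Set X)
    (hfin : ∀ t, (γ t).Finite) (hne : ∀ t, (γ t).Nonempty)
    (hlip : ∀ s t : unitInterval, Metric.hausdorffDist (γ s) (γ t) ≤ L * dist s t)
    (a : X) (ha : a ∈ γ 0) :
    ∃ c : unitInterval → X, (∀ t, c t ∈ γ t) ∧ c 0 = a ∧
      ∀ s t, dist (c s) (c t) ≤ L * dist s t := by
  classical
  choose g hg0 hg using fsn_finite L γ hfin hne hlip a ha
  have : ∀ t, Finite (γ t) := fun t => (hfin t).to_subtype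
  obtain ⟨χ, hχ⟩ := Finset.rado_selection g
  refine ⟨fun t => χ t, fun t => (χ t).2, ?_, ?_⟩
  · obtain ⟨T, hT, h⟩ := hχ {0}
    simp only [h 0 (by simp), hg0]
  · intro s t
    obtain ⟨T, hT, h⟩ := hχ {s, t}
    simp only [h s (by simp), h t (by simp)]
    exact hg T s (Finset.mem_insert_of_mem (hT (by simp))) t
      (Finset.mem_insert_of_mem (hT (by simp)))

/-- Criterion for Lipschitz paths in `FS_n(X)`: for nonempty finite subsets `x, y ⊆ X` of
cardinality at most `n`, an `L`-Lipschitz path from `x` to `y` through nonempty finite subsets of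
cardinality at most `n` exists iff there is a complete relation `R ⊆ x × y` and a family of
`L`-Lipschitz paths `c_{(a,b)}` from `a` to `b` for `(a,b) ∈ R` whose values at each time `t`
form a set of cardinality at most `n`. -/
theorem lipschitz_path_FSn_iff {X : Type*} [MetricSpace X] (n : ℕ) (hn : 1 ≤ n)
    (L : ℝ) (hL : 0 ≤ L) (x y : Set X)
    (hxfin : x.Finite) (hxne : x.Nonempty) (hxcard : x.ncard ≤ n)
    (hyfin : y.Finite) (hyne : y.Nonempty) (hycard : y.ncard ≤ n) :
    (∃ γ : unitInterval → Set X, γ 0 = x ∧ γ 1 = y ∧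
        (∀ t : unitInterval, (γ t).Finite ∧ (γ t).Nonempty ∧ (γ t).ncard ≤ n) ∧
        ∀ s t : unitInterval, Metric.hausdorffDist (γ s) (γ t) ≤ L * dist s t) ↔
    (∃ R : Set (X × X), R ⊆ x ×ˢ y ∧
        (∀ a ∈ x, ∃ b, (a, b) ∈ R) ∧ (∀ b ∈ y, ∃ a, (a, b) ∈ R) ∧
        ∃ c : X × X → unitInterval → X,
          (∀ r ∈ R, (∀ s t : unitInterval, dist (c r s) (c r t) ≤ L * dist s t) ∧
            c r 0 = r.1 ∧ c r 1 = r.2) ∧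
          ∀ t : unitInterval, {p | ∃ r ∈ R, c r t = p}.ncard ≤ n) := by
  constructor
  · rintro ⟨γ, h0, h1, hγ, hlip⟩
    have hfin : ∀ t, (γ t).Finite := fun t => (hγ t).1
    have hne : ∀ t, (γ t).Nonempty := fun t => (hγ t).2.1
    have hdsymm : ∀ s t : unitInterval, dist (σ s) (σ t) = dist s t := by
      intro s t
      simp only [Subtype.dist_eq, unitInterval.coe_symm_eq, Real.dist_eq]
      rw [← abs_neg]
      congr 1
      ring
    let S : Set (unitInterval → X) :=
      {c | (∀ t, c t ∈ γ t) ∧ ∀ s t, dist (c s) (c t) ≤ L * dist s t}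
    let R : Set (X × X) := {r | ∃ c ∈ S, c 0 = r.1 ∧ c 1 = r.2}
    have hR : ∀ r : X × X, ∃ c : unitInterval → X, r ∈ R → c ∈ S ∧ c 0 = r.1 ∧ c 1 = r.2 := by
      intro r
      by_cases hr : r ∈ R
      · obtain ⟨c, hc⟩ := hr
        exact ⟨c, fun _ => hc⟩
      · exact ⟨fun _ => r.1, fun h => absurd h hr⟩
    choose c hc using hR
    refine ⟨R, ?_, ?_, ?_, c, ?_, ?_⟩
    · rintro ⟨a, b⟩ ⟨d, hd, rfl, rfl⟩
      exact ⟨h0 ▸ hd.1 0, h1 ▸ hd.1 1⟩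
    · intro a ha
      obtain ⟨d, hd, hd0, hdl⟩ := fsn_selection L γ hfin hne hlip a (h0 ▸ ha)
      exact ⟨d 1, d, ⟨hd, hdl⟩, hd0, rfl⟩
    · intro b hb
      obtain ⟨d, hd, hd0, hdl⟩ := fsn_selection L (fun t => γ (σ t)) (fun t => hfin _)
        (fun t => hne _) (fun s t => by rw [← hdsymm s t]; exact hlip _ _) b
        (by simpa [h1] using hb)
      refine ⟨d 1, fun t => d (σ t), ⟨fun t => by simpa using hd (σ t), fun s t => ?_⟩, ?_, ?_⟩
      · rw [← hdsymm s t]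
        exact hdl _ _
      · simp
      · simpa using hd0
    · intro r hr
      exact ⟨(hc r hr).1.2, (hc r hr).2⟩
    · intro t
      refine (Set.ncard_le_ncard ?_ (hfin t)).trans (hγ t).2.2
      rintro p ⟨r, hr, rfl⟩
      exact (hc r hr).1.1 t
  · rintro ⟨R, hRs, hR1, hR2, c, hc, hcard⟩
    have hRfin : R.Finite := (hxfin.prod hyfin).subset hRs
    refine ⟨fun t => {p | ∃ r ∈ R, c r t = p}, ?_, ?_, fun t => ⟨?_, ?_, hcard t⟩, ?_⟩
    · ext p
      constructor
      · rintro ⟨r, hr, rfl⟩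
        rw [(hc r hr).2.1]
        exact (hRs hr).1
      · intro hp
        obtain ⟨b, hb⟩ := hR1 p hp
        exact ⟨_, hb, (hc _ hb).2.1⟩
    · ext p
      constructor
      · rintro ⟨r, hr, rfl⟩
        rw [(hc r hr).2.2]
        exact (hRs hr).2
      · intro hp
        obtain ⟨b, hb⟩ := hR2 p hp
        exact ⟨_, hb, (hc _ hb).2.2⟩
    · exact hRfin.image (fun r => c r t)
    · obtain ⟨a, ha⟩ := hxne
      obtain ⟨b, hb⟩ := hR1 a ha
      exact ⟨_, _, hb, rfl⟩
    · intro s t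
      apply Metric.hausdorffDist_le_of_mem_dist (mul_nonneg hL dist_nonneg)
      · rintro _ ⟨r, hr, rfl⟩
        exact ⟨_, ⟨r, hr, rfl⟩, (hc r hr).1 s t⟩
      · rintro _ ⟨r, hr, rfl⟩
        refine ⟨_, ⟨r, hr, rfl⟩, ?_⟩
        rw [dist_comm s t]
        exact (hc r hr).1 t s
end

section
/- Let λ ≥ 1, α ≥ 1, let X be a λ-quasiconvex metric space, let n ≤ m be positive integers, and let x, y be nonempty finite subsets of X with |x| ≤ n and |y| ≤ n. If there exists a complete, α-proximal relation R ⊆ x × y with |R| ≤ m, then there is a map γ : [0,1] → Set X with γ(0) = x, γ(1) = y, every γ(t) a nonempty finite subset of X with |γ(t)| ≤ m, and d_H(γ(s), γ(t)) ≤ λα·d_H(x,y)·|s−t| for all s,t ∈ [0,1] (a λα-quasigeodesic between x and y in FS_m(X)). -/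
open unitInterval

/-- Sufficient condition for Lipschitz paths in `FS(X)`: if `X` is `λ`-quasiconvex, `x, y` are
nonempty finite subsets of cardinality at most `n ≤ m`, and there is a complete `α`-proximal
relation `R ⊆ x × y` with `|R| ≤ m`, then there is a `λα`-quasigeodesic between `x` and `y` in
`FS_m(X)`. -/
theorem quasigeodesic_FSm_of_proximal_relation {X : Type*} [MetricSpace X]
    (lam alpha : ℝ) (hlam : 1 ≤ lam) (halpha : 1 ≤ alpha) (hX : QuasiconvexSpace X lam)
    (n m : ℕ) (hn : 1 ≤ n) (hnm : n ≤ m) (x y : Set X)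
    (hxfin : x.Finite) (hxne : x.Nonempty) (hxcard : x.ncard ≤ n)
    (hyfin : y.Finite) (hyne : y.Nonempty) (hycard : y.ncard ≤ n)
    (R : Set (X × X)) (hRsub : R ⊆ x ×ˢ y)
    (hRl : ∀ a ∈ x, ∃ b, (a, b) ∈ R) (hRr : ∀ b ∈ y, ∃ a, (a, b) ∈ R)
    (hRprox : ∀ r ∈ R, dist r.1 r.2 ≤ alpha * Metric.hausdorffDist x y)
    (hRcard : R.ncard ≤ m) :
    ∃ γ : unitInterval → Set X, γ 0 = x ∧ γ 1 = y ∧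
      (∀ t : unitInterval, (γ t).Finite ∧ (γ t).Nonempty ∧ (γ t).ncard ≤ m) ∧
      ∀ s t : unitInterval,
        Metric.hausdorffDist (γ s) (γ t) ≤ lam * alpha * Metric.hausdorffDist x y * dist s t := by
  have hRfin : R.Finite := (hxfin.prod hyfin).subset hRsub
  choose g _ hg0 hg1 hgL using hX
  have hRne : R.Nonempty := by
    obtain ⟨a, ha⟩ := hxne
    obtain ⟨b, hb⟩ := hRl a ha
    exact ⟨(a, b), hb⟩
  have key : ∀ s t : unitInterval, ∀ r ∈ R, dist (g r.1 r.2 s) (g r.1 r.2 t) ≤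
      lam * alpha * Metric.hausdorffDist x y * dist s t := by
    intro s t r hr
    refine (hgL r.1 r.2 s t).trans ?_
    have h := mul_le_mul_of_nonneg_left (hRprox r hr) (by linarith : (0:ℝ) ≤ lam)
    have h2 := mul_le_mul_of_nonneg_right h (dist_nonneg (x := s) (y := t))
    linarith
  refine ⟨fun t => (fun r : X × X => g r.1 r.2 t) '' R, ?_, ?_, ?_, ?_⟩
  · ext a
    simp only [Set.mem_image, hg0]
    constructor
    · rintro ⟨r, hr, rfl⟩
      exact (hRsub hr).1
    · intro ha
      obtain ⟨b, hb⟩ := hRl a ha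
      exact ⟨(a, b), hb, rfl⟩
  · ext b
    simp only [Set.mem_image, hg1]
    constructor
    · rintro ⟨r, hr, rfl⟩
      exact (hRsub hr).2
    · intro hb
      obtain ⟨a, ha⟩ := hRr b hb
      exact ⟨(a, b), ha, rfl⟩
  · intro t
    exact ⟨hRfin.image _, hRne.image _, (Set.ncard_image_le hRfin).trans hRcard⟩
  · intro s t
    apply Metric.hausdorffDist_le_of_mem_dist
    · obtain ⟨r, hr⟩ := hRne
      exact dist_nonneg.trans (key s t r hr)
    · rintro _ ⟨r, hr, rfl⟩
      exact ⟨_, ⟨r, hr, rfl⟩, key s t r hr⟩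
    · rintro _ ⟨r, hr, rfl⟩
      refine ⟨_, ⟨r, hr, rfl⟩, ?_⟩
      rw [dist_comm]
      exact key s t r hr
end

section
/- Let X be a geodesic metric space containing at least two distinct points, and let n ≥ 3. Then there exist nonempty finite subsets x, y of X with |x| ≤ n, |y| ≤ n, and d_H(x,y) > 0 which form a spaced pair in FS_n(X): for every nonempty finite subset z ⊆ X with |z| ≤ n, d_H(x,y) ≤ max(d_H(x,z), d_H(z,y)). Consequently, for every λ ≥ 1, if γ : [0,1] → Set X is a map with γ(0) = x, γ(1) = y, every γ(t) a nonempty finite subset with |γ(t)| ≤ n, and d_H(γ(s), γ(t)) ≤ λ·d_H(x,y)·|s−t| for all s,t ∈ [0,1], then λ ≥ 2. In particular, FS_n(X) is not a geodesic space. -/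
open unitInterval

/-- Equally spaced points along a geodesic. -/
theorem exists_spaced_points {X : Type*} [MetricSpace X] (hX : QuasiconvexSpace X 1)
    (hpts : ∃ p q : X, p ≠ q) (N : ℕ) (hN : 0 < N) :
    ∃ c : ℝ, 0 < c ∧ ∃ P : ℕ → X, ∀ i j : ℕ, i ≤ j → j ≤ N →
      dist (P i) (P j) = c * ((j : ℝ) - i) := by
  obtain ⟨p, q, hpq⟩ := hpts
  obtain ⟨γ, -, h0, h1, hL⟩ := hX p q
  have hD : 0 < dist p q := dist_pos.2 hpq
  have hN' : (0 : ℝ) < N := by exact_mod_cast hN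
  have key : ∀ s t : unitInterval, (s : ℝ) ≤ t → dist (γ s) (γ t) = dist p q * ((t : ℝ) - s) := by
    intro s t hst
    have e1 := hL s t
    have e2 := hL 0 s
    have e3 := hL t 1
    have t1 := dist_triangle4 (γ 0) (γ s) (γ t) (γ 1)
    rw [h0, h1] at t1
    rw [h0] at e2
    rw [h1] at e3
    have hs := s.2.1
    have ht := t.2.2
    rw [Subtype.dist_eq, Real.dist_eq, abs_of_nonpos (by linarith)] at e1
    rw [Subtype.dist_eq, Real.dist_eq, abs_of_nonpos (by simpa using hs)] at e2
    rw [Subtype.dist_eq, Real.dist_eq, abs_of_nonpos (by simpa using ht)] at e3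
    simp only [Set.Icc.coe_zero, Set.Icc.coe_one] at e2 e3
    apply le_antisymm
    · linarith
    · nlinarith
  refine ⟨dist p q / N, by positivity,
    fun i => γ (Set.projIcc 0 1 zero_le_one ((i : ℝ) / N)), ?_⟩
  intro i j hij hj
  have hij' : (i : ℝ) ≤ j := by exact_mod_cast hij
  have hj' : (j : ℝ) ≤ N := by exact_mod_cast hj
  have mj : (j : ℝ) / N ∈ Set.Icc (0 : ℝ) 1 := ⟨by positivity, (div_le_one hN').2 hj'⟩
  have mi : (i : ℝ) / N ∈ Set.Icc (0 : ℝ) 1 :=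
    ⟨by positivity, (div_le_one hN').2 (hij'.trans hj')⟩
  beta_reduce
  rw [Set.projIcc_of_mem _ mi, Set.projIcc_of_mem _ mj, key _ _ (by
    show (i : ℝ) / N ≤ (j : ℝ) / N
    gcongr)]
  show dist p q * ((j : ℝ) / N - (i : ℝ) / N) = _
  field_simp

theorem exists_near {X : Type*} [MetricSpace X] {s t : Set X} (hs : s.Finite) (ht : t.Finite)
    (hsn : s.Nonempty) (htn : t.Nonempty) {c : ℝ} (h : Metric.hausdorffDist s t < c)
    {a : X} (ha : a ∈ s) : ∃ b ∈ t, dist a b < c :=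
  Metric.exists_dist_lt_of_hausdorffDist_lt ha h
    (Metric.hausdorffEDist_ne_top_of_nonempty_of_bounded hsn htn hs.isBounded ht.isBounded)

theorem FSn_not_geodesic {X : Type*} [MetricSpace X] (hX : QuasiconvexSpace X 1)
    (hpts : ∃ p q : X, p ≠ q) (n : ℕ) (hn : 3 ≤ n) :
    ∃ x y : Set X,
      x.Finite ∧ x.Nonempty ∧ x.ncard ≤ n ∧
      y.Finite ∧ y.Nonempty ∧ y.ncard ≤ n ∧
      0 < Metric.hausdorffDist x y ∧
      (∀ z : Set X, z.Finite → z.Nonempty → z.ncard ≤ n →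
        Metric.hausdorffDist x y ≤
          max (Metric.hausdorffDist x z) (Metric.hausdorffDist z y)) ∧
      (∀ lam : ℝ, 1 ≤ lam → ∀ γ : unitInterval → Set X, γ 0 = x → γ 1 = y →
        (∀ t : unitInterval, (γ t).Finite ∧ (γ t).Nonempty ∧ (γ t).ncard ≤ n) →
        (∀ s t : unitInterval,
          Metric.hausdorffDist (γ s) (γ t) ≤ lam * Metric.hausdorffDist x y * dist s t) →
        2 ≤ lam) := by
  obtain ⟨c, hc, P, hP⟩ := exists_spaced_points hX hpts (2 * n) (by omega)
  let A : Finset ℕ := insert 1 ((Finset.Icc 2 n).image (2 * ·))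
  let B : Finset ℕ := insert 0 (insert 2 (insert 5 ((Finset.Icc 4 n).image (2 * ·))))
  have hA : A.card ≤ n := by
    have h1 := Finset.card_insert_le 1 ((Finset.Icc 2 n).image (2 * ·))
    have h2 : ((Finset.Icc 2 n).image (2 * ·)).card ≤ _ := Finset.card_image_le
    rw [Nat.card_Icc] at h2
    show (insert 1 ((Finset.Icc 2 n).image (2 * ·))).card ≤ n
    omega
  have hB : B.card ≤ n := by
    have h1 := Finset.card_insert_le 0 (insert 2 (insert 5 ((Finset.Icc 4 n).image (2 * ·))))
    have h3 := Finset.card_insert_le 2 (insert 5 ((Finset.Icc 4 n).image (2 * ·)))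
    have h4 := Finset.card_insert_le 5 ((Finset.Icc 4 n).image (2 * ·))
    have h2 : ((Finset.Icc 4 n).image (2 * ·)).card ≤ _ := Finset.card_image_le
    rw [Nat.card_Icc] at h2
    show (insert 0 (insert 2 (insert 5 ((Finset.Icc 4 n).image (2 * ·))))).card ≤ n
    omega
  have memA : ∀ k, k ∈ A ↔ k = 1 ∨ ∃ i, (2 ≤ i ∧ i ≤ n) ∧ 2 * i = k := by
    intro k; simp [A]
  have memB : ∀ k, k ∈ B ↔ k = 0 ∨ k = 2 ∨ k = 5 ∨ ∃ i, (4 ≤ i ∧ i ≤ n) ∧ 2 * i = k := by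
    intro k; simp [B]
  set x : Set X := P '' (A : Set ℕ) with hx
  set y : Set X := P '' (B : Set ℕ) with hy
  have xf : x.Finite := A.finite_toSet.image P
  have yf : y.Finite := B.finite_toSet.image P
  have xm : ∀ k ∈ A, P k ∈ x := fun k hk => ⟨k, by exact_mod_cast hk, rfl⟩
  have ym : ∀ k ∈ B, P k ∈ y := fun k hk => ⟨k, by exact_mod_cast hk, rfl⟩
  have xn : x.Nonempty := ⟨P 1, xm 1 (by simp [memA])⟩
  have yn : y.Nonempty := ⟨P 0, ym 0 (by simp [memB])⟩
  have xc : x.ncard ≤ n := by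
    have := Set.ncard_image_le (f := P) A.finite_toSet
    rw [Set.ncard_coe_finset] at this
    exact this.trans hA
  have yc : y.ncard ≤ n := by
    have := Set.ncard_image_le (f := P) B.finite_toSet
    rw [Set.ncard_coe_finset] at this
    exact this.trans hB
  have step : ∀ i, i + 1 ≤ 2 * n → dist (P i) (P (i + 1)) ≤ c := by
    intro i hi
    rw [hP i (i + 1) (by omega) hi]
    push_cast
    linarith
  have step' : ∀ i, i + 1 ≤ 2 * n → dist (P (i + 1)) (P i) ≤ c := by
    intro i hi
    rw [dist_comm]; exact step i hi
  have hle : Metric.hausdorffDist x y ≤ c := by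
    apply Metric.hausdorffDist_le_of_mem_dist hc.le
    · rintro _ ⟨k, hk, rfl⟩
      rcases (memA k).1 (by exact_mod_cast hk) with rfl | ⟨i, ⟨hi, hi'⟩, rfl⟩
      · exact ⟨P 0, ym 0 (by simp [memB]), step' 0 (by omega)⟩
      · by_cases h2 : i = 2
        · subst h2
          exact ⟨P 5, ym 5 (by simp [memB]), step 4 (by omega)⟩
        by_cases h3 : i = 3
        · subst h3
          exact ⟨P 5, ym 5 (by simp [memB]), step' 5 (by omega)⟩
        · exact ⟨P (2 * i), ym _ ((memB _).2 (Or.inr (Or.inr (Or.inr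
            ⟨i, ⟨by omega, hi'⟩, rfl⟩)))), by simp [hc.le]⟩
    · rintro _ ⟨k, hk, rfl⟩
      rcases (memB k).1 (by exact_mod_cast hk) with rfl | rfl | rfl | ⟨i, ⟨hi, hi'⟩, rfl⟩
      · exact ⟨P 1, xm 1 (by simp [memA]), step 0 (by omega)⟩
      · exact ⟨P 1, xm 1 (by simp [memA]), step' 1 (by omega)⟩
      · exact ⟨P 4, xm 4 ((memA _).2 (Or.inr ⟨2, ⟨by omega, by omega⟩, rfl⟩)),
          step' 4 (by omega)⟩
      · exact ⟨P (2 * i), xm _ ((memA _).2 (Or.inr ⟨i, ⟨by omega, hi'⟩, rfl⟩)),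
          by simp [hc.le]⟩
  have hpos : 0 < Metric.hausdorffDist x y := by
    refine lt_of_lt_of_le hc ?_
    by_contra! hlt
    rw [Metric.hausdorffDist_comm] at hlt
    obtain ⟨b, ⟨k, hk, rfl⟩, hb⟩ := exists_near yf xf yn xn hlt (ym 0 (by simp [memB]))
    have hk1 : 1 ≤ k ∧ k ≤ 2 * n := by
      rcases (memA k).1 (by exact_mod_cast hk) with rfl | ⟨i, ⟨hi, hi'⟩, rfl⟩ <;> omega
    rw [hP 0 k (by omega) hk1.2] at hb
    have : (1 : ℝ) ≤ k := by exact_mod_cast hk1.1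
    push_cast at hb
    nlinarith
  have spaced : ∀ z : Set X, z.Finite → z.Nonempty → z.ncard ≤ n →
        Metric.hausdorffDist x y ≤
          max (Metric.hausdorffDist x z) (Metric.hausdorffDist z y) := by
    intro z zf zn zc
    by_contra! hlt
    obtain ⟨l1, l2⟩ := max_lt_iff.1 hlt
    replace l1 := l1.trans_le hle
    replace l2 := l2.trans_le hle
    rw [Metric.hausdorffDist_comm] at l2
    have hw : ∀ i : ℕ, ∃ w, i ≤ n → w ∈ z ∧ dist (P (2 * i)) w < c := by
      intro i
      by_cases hi : i ≤ n
      · by_cases h2 : 2 ≤ i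
        · obtain ⟨w, h1, h2⟩ := exists_near xf zf xn zn l1
            (xm (2 * i) ((memA _).2 (Or.inr ⟨i, ⟨h2, hi⟩, rfl⟩)))
          exact ⟨w, fun _ => ⟨h1, h2⟩⟩
        · obtain ⟨w, h1, h2⟩ := exists_near yf zf yn zn l2
            (ym (2 * i) ((memB _).2 (by omega)))
          exact ⟨w, fun _ => ⟨h1, h2⟩⟩
      · exact ⟨P 0, fun h => absurd h hi⟩
    choose w hw using hw
    have hinj : ∀ i j, i < j → j ≤ n → w i ≠ w j := by
      intro i j hij hj he
      have a1 := (hw i (by omega)).2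
      have a2 := (hw j hj).2
      have t := dist_triangle_right (P (2 * i)) (P (2 * j)) (w i)
      rw [hP _ _ (by omega) (by omega)] at t
      rw [← he] at a2
      have : (i : ℝ) + 1 ≤ j := by exact_mod_cast hij
      push_cast at t
      nlinarith
    have hcard : (Finset.range (n + 1) : Set ℕ).ncard ≤ z.ncard := by
      refine Set.ncard_le_ncard_of_injOn w ?_ ?_ zf
      · intro i hi
        exact (hw i (by simp at hi; omega)).1
      · intro i hi j hj he
        simp at hi hj
        rcases lt_trichotomy i j with h | h | h
        · exact absurd he (hinj i j h (by omega))
        · exact h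
        · exact absurd he.symm (hinj j i h (by omega))
    rw [Set.ncard_coe_finset, Finset.card_range] at hcard
    omega
  refine ⟨x, y, xf, xn, xc, yf, yn, yc, hpos, spaced, ?_⟩
  intro lam _ γ g0 g1 hγ hL
  let m : unitInterval := ⟨1 / 2, by norm_num, by norm_num⟩
  obtain ⟨a, b, d⟩ := hγ m
  have s := spaced (γ m) a b d
  have e1 := hL 0 m
  have e2 := hL m 1
  have d1 : dist (0 : unitInterval) m = 1 / 2 := by
    rw [Subtype.dist_eq, Real.dist_eq]; norm_num [m]
  have d2 : dist m (1 : unitInterval) = 1 / 2 := by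
    rw [Subtype.dist_eq, Real.dist_eq]; norm_num [m, abs_of_nonpos]
  rw [d1, g0] at e1
  rw [d2, g1] at e2
  have := s.trans (max_le e1 e2)
  nlinarith
end

section
/- Let X be a metric space and let x, y be nonempty finite subsets of X. Then there exists a complete relation R ⊆ x × y which is proximal, i.e. d(a,b) ≤ d_H(x,y) for all (a,b) ∈ R, and which satisfies |R| ≤ |x| + |y|. Moreover, if |x| ≥ 2 and |y| ≥ 2, then R can be chosen with |R| ≤ |x| + |y| − 2. -/
theorem exists_near_aux {X : Type*} [MetricSpace X] (x y : Set X)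
    (hxfin : x.Finite) (hxne : x.Nonempty) (hyfin : y.Finite) (hyne : y.Nonempty) :
    ∀ a ∈ x, ∃ b ∈ y, dist a b ≤ Metric.hausdorffDist x y := by
  intro a ha
  obtain ⟨b, hb, h⟩ := hyfin.isCompact.exists_infDist_eq_dist hyne a
  refine ⟨b, hb, h ▸ ?_⟩
  exact Metric.infDist_le_hausdorffDist_of_mem ha
    (Metric.hausdorffEDist_ne_top_of_nonempty_of_bounded hxne hyne hxfin.isBounded
      hyfin.isBounded)

/-- For nonempty finite subsets `x, y` of a metric space, there is a proximal complete relation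
`R ⊆ x × y` with `|R| ≤ |x| + |y|`; moreover, if `|x| ≥ 2` and `|y| ≥ 2`, then `R` can be chosen
with `|R| ≤ |x| + |y| − 2`. -/
theorem exists_proximal_complete_relation {X : Type*} [MetricSpace X] (x y : Set X)
    (hxfin : x.Finite) (hxne : x.Nonempty) (hyfin : y.Finite) (hyne : y.Nonempty) :
    (∃ R : Set (X × X), R ⊆ x ×ˢ y ∧
        (∀ a ∈ x, ∃ b, (a, b) ∈ R) ∧ (∀ b ∈ y, ∃ a, (a, b) ∈ R) ∧
        (∀ r ∈ R, dist r.1 r.2 ≤ Metric.hausdorffDist x y) ∧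
        R.ncard ≤ x.ncard + y.ncard) ∧
      (2 ≤ x.ncard → 2 ≤ y.ncard →
        ∃ R : Set (X × X), R ⊆ x ×ˢ y ∧
          (∀ a ∈ x, ∃ b, (a, b) ∈ R) ∧ (∀ b ∈ y, ∃ a, (a, b) ∈ R) ∧
          (∀ r ∈ R, dist r.1 r.2 ≤ Metric.hausdorffDist x y) ∧
          R.ncard ≤ x.ncard + y.ncard - 2) := by
  have hf := exists_near_aux x y hxfin hxne hyfin hyne
  have hg : ∀ b ∈ y, ∃ a ∈ x, dist a b ≤ Metric.hausdorffDist x y := by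
    intro b hb
    obtain ⟨a, ha, h⟩ := exists_near_aux y x hyfin hyne hxfin hxne b hb
    exact ⟨a, ha, by rwa [dist_comm, Metric.hausdorffDist_comm]⟩
  have : Nonempty X := ⟨hxne.some⟩
  choose! f hfy hfd using hf
  choose! g hgx hgd using hg
  constructor
  · refine ⟨Set.image (fun a => (a, f a)) x ∪ Set.image (fun b => (g b, b)) y, ?_, ?_, ?_, ?_, ?_⟩
    · rintro r (⟨a, ha, rfl⟩ | ⟨b, hb, rfl⟩)
      · exact ⟨ha, hfy a ha⟩
      · exact ⟨hgx b hb, hb⟩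
    · exact fun a ha => ⟨f a, Or.inl ⟨a, ha, rfl⟩⟩
    · exact fun b hb => ⟨g b, Or.inr ⟨b, hb, rfl⟩⟩
    · rintro r (⟨a, ha, rfl⟩ | ⟨b, hb, rfl⟩)
      · exact hfd a ha
      · exact hgd b hb
    · exact (Set.ncard_union_le _ _).trans
        (add_le_add (Set.ncard_image_le hxfin) (Set.ncard_image_le hyfin))
  · intro hx2 hy2
    have key : ∃ a₁ ∈ x, ∃ a₂ ∈ x, ∃ b₁ ∈ y, ∃ b₂ ∈ y, a₁ ≠ a₂ ∧ b₁ ≠ b₂ ∧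
        dist a₁ b₁ ≤ Metric.hausdorffDist x y ∧ dist a₂ b₂ ≤ Metric.hausdorffDist x y := by
      by_cases h : ∃ a₁ ∈ x, ∃ a₂ ∈ x, f a₁ ≠ f a₂
      · obtain ⟨a₁, h₁, a₂, h₂, hne⟩ := h
        exact ⟨a₁, h₁, a₂, h₂, f a₁, hfy _ h₁, f a₂, hfy _ h₂, fun e => hne (by rw [e]), hne,
          hfd _ h₁, hfd _ h₂⟩
      · push Not at h
        obtain ⟨a₀, h₀⟩ := hxne
        obtain ⟨b₁, hb₁, hne⟩ := Set.exists_ne_of_one_lt_ncard (s := y) (by omega) (f a₀)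
        obtain ⟨a₂, ha₂, hne₂⟩ := Set.exists_ne_of_one_lt_ncard (s := x) (by omega) (g b₁)
        refine ⟨g b₁, hgx _ hb₁, a₂, ha₂, b₁, hb₁, f a₂, hfy _ ha₂, hne₂.symm, ?_,
          hgd _ hb₁, hfd _ ha₂⟩
        rw [h a₂ ha₂ a₀ h₀]
        exact hne
    obtain ⟨a₁, ha₁, a₂, ha₂, b₁, hb₁, b₂, hb₂, hane, hbne, hd₁, hd₂⟩ := key
    refine ⟨{(a₁, b₁), (a₂, b₂)} ∪ (Set.image (fun a => (a, f a)) (x \ {a₁, a₂}) ∪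
      Set.image (fun b => (g b, b)) (y \ {b₁, b₂})), ?_, ?_, ?_, ?_, ?_⟩
    · rintro r ((rfl | rfl) | ⟨a, ha, rfl⟩ | ⟨b, hb, rfl⟩)
      · exact ⟨ha₁, hb₁⟩
      · exact ⟨ha₂, hb₂⟩
      · exact ⟨ha.1, hfy a ha.1⟩
      · exact ⟨hgx b hb.1, hb.1⟩
    · intro a ha
      by_cases h : a ∈ ({a₁, a₂} : Set X)
      · rcases h with rfl | rfl
        · exact ⟨b₁, Or.inl (Or.inl rfl)⟩
        · exact ⟨b₂, Or.inl (Or.inr rfl)⟩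
      · exact ⟨f a, Or.inr (Or.inl ⟨a, ⟨ha, h⟩, rfl⟩)⟩
    · intro b hb
      by_cases h : b ∈ ({b₁, b₂} : Set X)
      · rcases h with rfl | rfl
        · exact ⟨a₁, Or.inl (Or.inl rfl)⟩
        · exact ⟨a₂, Or.inl (Or.inr rfl)⟩
      · exact ⟨g b, Or.inr (Or.inr ⟨b, ⟨hb, h⟩, rfl⟩)⟩
    · rintro r ((rfl | rfl) | ⟨a, ha, rfl⟩ | ⟨b, hb, rfl⟩)
      · exact hd₁
      · exact hd₂
      · exact hfd a ha.1
      · exact hgd b hb.1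
    · have e₁ : (x \ {a₁, a₂}).ncard = x.ncard - 2 := by
        rw [Set.ncard_sdiff (Set.pair_subset ha₁ ha₂), Set.ncard_pair hane]
      have e₂ : (y \ {b₁, b₂}).ncard = y.ncard - 2 := by
        rw [Set.ncard_sdiff (Set.pair_subset hb₁ hb₂), Set.ncard_pair hbne]
      have i₁ := Set.ncard_image_le (f := fun a => (a, f a))
        (hxfin.subset (Set.sdiff_subset : x \ {a₁, a₂} ⊆ x))
      have i₂ := Set.ncard_image_le (f := fun b => (g b, b))
        (hyfin.subset (Set.sdiff_subset : y \ {b₁, b₂} ⊆ y))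
      have p : ({(a₁, b₁), (a₂, b₂)} : Set (X × X)).ncard = 2 :=
        Set.ncard_pair (fun e => hane (congrArg Prod.fst e))
      refine (Set.ncard_union_le _ _).trans ?_
      have u := Set.ncard_union_le (Set.image (fun a => (a, f a)) (x \ {a₁, a₂}))
        (Set.image (fun b => (g b, b)) (y \ {b₁, b₂}))
      omega
end

section
/- Let X be a geodesic metric space, n ≥ 2, and m ≥ 2n − 2. Then any two nonempty finite subsets x, y of X with |x| ≤ n and |y| ≤ n can be connected by a geodesic in FS_m(X): there is a map γ : [0,1] → Set X with γ(0) = x, γ(1) = y, every γ(t) a nonempty finite subset of X with |γ(t)| ≤ m, and d_H(γ(s), γ(t)) ≤ d_H(x,y)·|s−t| for all s,t ∈ [0,1]. -/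
open unitInterval

theorem exists_cover_card {X : Type*} (E : X → X → Prop) (n : ℕ) (hn : 2 ≤ n)
    (x y : Finset X) (hx : x.card ≤ n) (hy : y.card ≤ n)
    (h1 : ∀ a ∈ x, ∃ b ∈ y, E a b) (h2 : ∀ b ∈ y, ∃ a ∈ x, E a b) :
    ∃ R : Finset (X × X), (∀ e ∈ R, e.1 ∈ x ∧ e.2 ∈ y ∧ E e.1 e.2) ∧
      (∀ a ∈ x, ∃ e ∈ R, e.1 = a) ∧ (∀ b ∈ y, ∃ e ∈ R, e.2 = b) ∧ R.card ≤ 2 * n - 2 := by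
  classical
  let P : Finset (X × X) → Prop := fun R => (∀ e ∈ R, e.1 ∈ x ∧ e.2 ∈ y ∧ E e.1 e.2) ∧
      (∀ a ∈ x, ∃ e ∈ R, e.1 = a) ∧ (∀ b ∈ y, ∃ e ∈ R, e.2 = b)
  have hP : ∃ R, P R := by
    refine ⟨(x ×ˢ y).filter (fun e => E e.1 e.2), ?_, ?_, ?_⟩
    · intro e he
      simp only [Finset.mem_filter, Finset.mem_product] at he
      tauto
    · intro a ha
      obtain ⟨b, hb, hab⟩ := h1 a ha
      exact ⟨(a, b), by simp [ha, hb, hab], rfl⟩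
    · intro b hb
      obtain ⟨a, ha, hab⟩ := h2 b hb
      exact ⟨(a, b), by simp [ha, hb, hab], rfl⟩
  obtain ⟨R, hR, hmin⟩ := exists_minimal_of_wellFoundedLT P hP
  obtain ⟨r1, r2, r3⟩ := hR
  refine ⟨R, r1, r2, r3, ?_⟩
  have key : ∀ e ∈ R, (∀ e' ∈ R, e'.1 = e.1 → e' = e) ∨ (∀ e' ∈ R, e'.2 = e.2 → e' = e) := by
    intro e he
    by_contra hcon
    push Not at hcon
    obtain ⟨⟨f, hf, hf1, hf2⟩, ⟨g, hg, hg1, hg2⟩⟩ := hcon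
    have hPe : P (R.erase e) := by
      refine ⟨fun d hd => r1 d (Finset.mem_of_mem_erase hd), ?_, ?_⟩
      · intro a ha
        obtain ⟨d, hd, rfl⟩ := r2 a ha
        by_cases hde : d = e
        · subst hde
          exact ⟨f, Finset.mem_erase.2 ⟨hf2, hf⟩, hf1⟩
        · exact ⟨d, Finset.mem_erase.2 ⟨hde, hd⟩, rfl⟩
      · intro b hb
        obtain ⟨d, hd, rfl⟩ := r3 b hb
        by_cases hde : d = e
        · subst hde
          exact ⟨g, Finset.mem_erase.2 ⟨hg2, hg⟩, hg1⟩
        · exact ⟨d, Finset.mem_erase.2 ⟨hde, hd⟩, rfl⟩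
    have := hmin hPe (Finset.erase_subset e R) he
    simp at this
  let A := R.filter (fun e => ∀ e' ∈ R, e'.1 = e.1 → e' = e)
  let B := R.filter (fun e => ∀ e' ∈ R, e'.2 = e.2 → e' = e)
  have hAB : R ⊆ A ∪ B := by
    intro e he
    rcases key e he with h | h
    · exact Finset.mem_union_left _ (Finset.mem_filter.2 ⟨he, h⟩)
    · exact Finset.mem_union_right _ (Finset.mem_filter.2 ⟨he, h⟩)
  have hcard : R.card ≤ A.card + B.card :=
    (Finset.card_le_card hAB).trans (Finset.card_union_le _ _)
  have hAi : (A.image Prod.fst).card = A.card := Finset.card_image_of_injOn (by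
    intro e he e' he' h
    simp only [A, Finset.coe_filter, Set.mem_ofPred_eq] at he he'
    exact he'.2 e he.1 h)
  have hBi : (B.image Prod.snd).card = B.card := Finset.card_image_of_injOn (by
    intro e he e' he' h
    simp only [B, Finset.coe_filter, Set.mem_ofPred_eq] at he he'
    exact he'.2 e he.1 h)
  have hAs : A.image Prod.fst ⊆ x := by
    intro a ha
    obtain ⟨e, he, rfl⟩ := Finset.mem_image.1 ha
    exact (r1 e (Finset.mem_filter.1 he).1).1
  have hBs : B.image Prod.snd ⊆ y := by
    intro a ha
    obtain ⟨e, he, rfl⟩ := Finset.mem_image.1 ha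
    exact (r1 e (Finset.mem_filter.1 he).1).2.1
  by_cases hAx : A.image Prod.fst = x
  · have : R ⊆ A := by
      intro e he
      have h := (r1 e he).1
      rw [← hAx] at h
      obtain ⟨d, hd, hde⟩ := Finset.mem_image.1 h
      rw [(Finset.mem_filter.1 hd).2 e he hde.symm]
      exact hd
    have := Finset.card_le_card this
    rw [hAx] at hAi
    omega
  by_cases hBy : B.image Prod.snd = y
  · have : R ⊆ B := by
      intro e he
      have h := (r1 e he).2.1
      rw [← hBy] at h
      obtain ⟨d, hd, hde⟩ := Finset.mem_image.1 h
      rw [(Finset.mem_filter.1 hd).2 e he hde.symm]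
      exact hd
    have := Finset.card_le_card this
    rw [hBy] at hBi
    omega
  have c1 := Finset.card_lt_card (hAs.ssubset_of_ne hAx)
  have c2 := Finset.card_lt_card (hBs.ssubset_of_ne hBy)
  omega

/-- If `X` is geodesic, `n ≥ 2`, and `m ≥ 2n − 2`, then any two nonempty finite subsets `x, y`
of `X` of cardinality at most `n` are connected by a geodesic in `FS_m(X)`. -/
theorem geodesic_FSm_of_FSn {X : Type*} [MetricSpace X] (hX : QuasiconvexSpace X 1)
    (n m : ℕ) (hn : 2 ≤ n) (hm : 2 * n - 2 ≤ m) (x y : Set X)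
    (hxfin : x.Finite) (hxne : x.Nonempty) (hxcard : x.ncard ≤ n)
    (hyfin : y.Finite) (hyne : y.Nonempty) (hycard : y.ncard ≤ n) :
    ∃ γ : unitInterval → Set X, γ 0 = x ∧ γ 1 = y ∧
      (∀ t : unitInterval, (γ t).Finite ∧ (γ t).Nonempty ∧ (γ t).ncard ≤ m) ∧
      ∀ s t : unitInterval,
        Metric.hausdorffDist (γ s) (γ t) ≤ Metric.hausdorffDist x y * dist s t := by
  classical
  have near : ∀ u v : Set X, u.Finite → u.Nonempty → v.Finite → v.Nonempty → ∀ a ∈ u,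
      ∃ b ∈ v, dist a b ≤ Metric.hausdorffDist u v := by
    intro u v hu hu' hv hv' a ha
    obtain ⟨b, hb, hab⟩ := hv.isCompact.exists_infDist_eq_dist hv' a
    refine ⟨b, hb, hab ▸ Metric.infDist_le_hausdorffDist_of_mem ha ?_⟩
    exact Metric.hausdorffEDist_ne_top_of_nonempty_of_bounded hu' hv' hu.isBounded hv.isBounded
  obtain ⟨R, r1, r2, r3, r4⟩ := exists_cover_card
    (fun a b : X => dist a b ≤ Metric.hausdorffDist x y) n hn hxfin.toFinset hyfin.toFinset
    (by rwa [← Set.ncard_eq_toFinset_card x hxfin])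
    (by rwa [← Set.ncard_eq_toFinset_card y hyfin])
    (by
      intro a ha
      obtain ⟨b, hb, h⟩ := near x y hxfin hxne hyfin hyne a (by simpa using ha)
      exact ⟨b, by simpa using hb, h⟩)
    (by
      intro b hb
      obtain ⟨a, ha, h⟩ := near y x hyfin hyne hxfin hxne b (by simpa using hb)
      refine ⟨a, by simpa using ha, ?_⟩
      rw [dist_comm, Metric.hausdorffDist_comm]
      exact h)
  simp only [Set.Finite.mem_toFinset] at r1 r2 r3
  choose p _ p0 p1 pl using hX
  have hlip : ∀ e ∈ R, ∀ s t, dist (p e.1 e.2 s) (p e.1 e.2 t) ≤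
      Metric.hausdorffDist x y * dist s t := by
    intro e he s t
    refine (pl e.1 e.2 s t).trans ?_
    rw [one_mul]
    exact mul_le_mul_of_nonneg_right (r1 e he).2.2 dist_nonneg
  refine ⟨fun t => (R.image (fun e => p e.1 e.2 t) : Finset X), ?_, ?_, ?_, ?_⟩
  · ext a
    simp only [p0, Finset.coe_image, Set.mem_image, Finset.mem_coe]
    exact ⟨fun ⟨e, he, h⟩ => h ▸ (r1 e he).1, r2 a⟩
  · ext a
    simp only [p1, Finset.coe_image, Set.mem_image, Finset.mem_coe]
    exact ⟨fun ⟨e, he, h⟩ => h ▸ (r1 e he).2.1, r3 a⟩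
  · intro t
    refine ⟨Finset.finite_toSet _, ?_, ?_⟩
    · obtain ⟨a, ha⟩ := hxne
      obtain ⟨e, he, _⟩ := r2 a ha
      exact ⟨p e.1 e.2 t, by simpa using ⟨e.1, e.2, he, rfl⟩⟩
    · rw [Set.ncard_coe_finset]
      exact Finset.card_image_le.trans (r4.trans hm)
  · intro s t
    refine Metric.hausdorffDist_le_of_mem_dist
      (mul_nonneg Metric.hausdorffDist_nonneg dist_nonneg) ?_ ?_
    · intro a ha
      obtain ⟨e, he, rfl⟩ := Finset.mem_image.1 (Finset.mem_coe.1 ha)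
      exact ⟨_, Finset.mem_coe.2 (Finset.mem_image_of_mem _ he), hlip e he s t⟩
    · intro a ha
      obtain ⟨e, he, rfl⟩ := Finset.mem_image.1 (Finset.mem_coe.1 ha)
      refine ⟨_, Finset.mem_coe.2 (Finset.mem_image_of_mem _ he), ?_⟩
      rw [dist_comm]
      exact hlip e he s t
end

section
/- Let X be a geodesic metric space and n ≥ 1. Then FS_n(X) is 2-quasiconvex: for any nonempty finite subsets x, y of X with |x| ≤ n and |y| ≤ n there is a map γ : [0,1] → Set X with γ(0) = x, γ(1) = y, every γ(t) a nonempty finite subset of X with |γ(t)| ≤ n, and d_H(γ(s), γ(t)) ≤ 2·d_H(x,y)·|s−t| for all s,t ∈ [0,1]. -/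
open unitInterval

lemma star_cover {X : Type*} (R : X → X → Prop) (x y : Finset X)
    (h1 : ∀ a ∈ x, ∃ b ∈ y, R a b) (h2 : ∀ b ∈ y, ∃ a ∈ x, R a b) :
    ∃ f g : X → X, f '' (x : Set X) = g '' (y : Set X) ∧
      (∀ a ∈ x, f a = a ∨ R a (f a)) ∧ (∀ b ∈ y, g b = b ∨ R (g b) b) := by
  classical
  let C : Finset (X × X) → Prop := fun E => (∀ e ∈ E, e.1 ∈ x ∧ e.2 ∈ y ∧ R e.1 e.2) ∧
    (∀ a ∈ x, ∃ b, (a, b) ∈ E) ∧ (∀ b ∈ y, ∃ a, (a, b) ∈ E)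
  have hC0 : C ((x ×ˢ y).filter (fun e => R e.1 e.2)) := by
    refine ⟨?_, ?_, ?_⟩
    · intro e he
      simp only [Finset.mem_filter, Finset.mem_product] at he
      exact ⟨he.1.1, he.1.2, he.2⟩
    · intro a ha
      obtain ⟨b, hb, hr⟩ := h1 a ha
      exact ⟨b, by simp [ha, hb, hr]⟩
    · intro b hb
      obtain ⟨a, ha, hr⟩ := h2 b hb
      exact ⟨a, by simp [ha, hb, hr]⟩
  obtain ⟨E, -, hE⟩ := exists_minimal_le_of_wellFoundedLT C _ hC0
  obtain ⟨⟨hER, hE1, hE2⟩, hmin⟩ := hE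
  have key : ∀ a b b' a', (a, b) ∈ E → (a, b') ∈ E → b' ≠ b → (a', b) ∈ E → a' = a := by
    intro a b b' a' hab hab' hbb ha'b
    by_contra hne
    have hc : C (E.erase (a, b)) := by
      refine ⟨fun e he => hER e (Finset.mem_of_mem_erase he), ?_, ?_⟩
      · intro c hc
        by_cases hca : c = a
        · exact ⟨b', by subst hca; simp [hbb, hab']⟩
        · obtain ⟨d, hd⟩ := hE1 c hc
          exact ⟨d, by simp [hca, hd]⟩
      · intro c hc
        by_cases hca : c = b
        · exact ⟨a', by subst hca; simp [hne, ha'b]⟩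
        · obtain ⟨d, hd⟩ := hE2 c hc
          exact ⟨d, by simp [hca, hd]⟩
    have := hmin hc (Finset.erase_subset _ _) hab
    simp at this
  let D : X → Prop := fun a => ∃ b b', (a, b) ∈ E ∧ (a, b') ∈ E ∧ b' ≠ b
  have hD : ∀ a, D a → ∀ b a', (a, b) ∈ E → (a', b) ∈ E → a' = a := by
    rintro a ⟨c, c', hc, hc', hne⟩ b a' hab ha'b
    by_cases h : c = b
    · exact key a b c' a' hab hc' (by rw [← h]; exact hne) ha'b
    · exact key a b c a' hab hc h ha'b
  have hD' : ∀ a, ¬ D a → ∀ b b', (a, b) ∈ E → (a, b') ∈ E → b' = b := by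
    intro a h b b' hb hb'
    by_contra hne
    exact h ⟨b, b', hb, hb', hne⟩
  choose! p hp using hE1
  choose! q hq using hE2
  refine ⟨fun a => if D a then a else p a, fun b => if D (q b) then q b else b, ?_, ?_, ?_⟩
  · ext z
    constructor
    · rintro ⟨a, ha, rfl⟩
      have hpa := hp a ha
      have hb := (hER _ hpa).2.1
      refine ⟨p a, hb, ?_⟩
      have hqb := hq _ hb
      by_cases h : D a
      · have := hD a h _ _ hpa hqb
        simp only [this, h, if_true]
      · have h' : ¬ D (q (p a)) := by
          intro h'
          have := hD _ h' _ _ hqb hpa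
          exact h (this ▸ h')
        simp only [h, h', if_false]
    · rintro ⟨b, hb, rfl⟩
      have hqb := hq b hb
      have ha := (hER _ hqb).1
      refine ⟨q b, ha, ?_⟩
      by_cases h : D (q b)
      · simp only [h, if_true]
      · simp only [h, if_false]
        exact hD' _ h _ _ hqb (hp _ ha)
  · intro a ha
    by_cases h : D a
    · left; simp only [h, if_true]
    · right; simp only [h, if_false]; exact (hER _ (hp a ha)).2.2
  · intro b hb
    by_cases h : D (q b)
    · right; simp only [h, if_true]; exact (hER _ (hq b hb)).2.2
    · left; simp only [h, if_false]

lemma exists_close {X : Type*} [MetricSpace X] {x y : Set X}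
    (hxfin : x.Finite) (hxne : x.Nonempty) (hyfin : y.Finite) (hyne : y.Nonempty) :
    ∀ a ∈ x, ∃ b ∈ y, dist a b ≤ Metric.hausdorffDist x y := by
  intro a ha
  obtain ⟨b, hb, h⟩ := hyfin.isCompact.exists_infDist_eq_dist hyne a
  refine ⟨b, hb, h ▸ Metric.infDist_le_hausdorffDist_of_mem ha ?_⟩
  exact Metric.hausdorffEDist_ne_top_of_nonempty_of_bounded hxne hyne
    hxfin.isBounded hyfin.isBounded

/-- a moving family from `x` to `f '' x`, with clamped time `τ`. -/
lemma moving {X : Type*} [MetricSpace X] (hX : QuasiconvexSpace X 1) (x : Set X)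
    (hxfin : x.Finite) (hxne : x.Nonempty) (f : X → X) (r : ℝ) (hr : 0 ≤ r)
    (hf : ∀ a ∈ x, dist a (f a) ≤ r) :
    ∃ A : unitInterval → Set X, A 0 = x ∧ A 1 = f '' x ∧
      (∀ t, (A t).Finite ∧ (A t).Nonempty ∧ (A t).ncard ≤ x.ncard) ∧
      ∀ s t, Metric.hausdorffDist (A s) (A t) ≤ r * dist s t := by
  choose P _ hP0 hP1 hP using hX
  refine ⟨fun t => (fun a => P a (f a) t) '' x, by simp [hP0], by simp [hP1], ?_, ?_⟩
  · intro t
    exact ⟨hxfin.image _, hxne.image _, Set.ncard_image_le hxfin⟩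
  · intro s t
    have hm : ∀ s t : unitInterval, ∀ a ∈ x, dist (P a (f a) s) (P a (f a) t) ≤ r * dist s t := by
      intro s t a ha
      refine (hP a (f a) s t).trans ?_
      rw [one_mul]
      exact mul_le_mul_of_nonneg_right (hf a ha) dist_nonneg
    apply Metric.hausdorffDist_le_of_mem_dist (by positivity)
    · rintro _ ⟨a, ha, rfl⟩
      exact ⟨_, ⟨a, ha, rfl⟩, hm s t a ha⟩
    · rintro _ ⟨a, ha, rfl⟩
      refine ⟨_, ⟨a, ha, rfl⟩, ?_⟩
      rw [dist_comm s t]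
      exact hm t s a ha

/-- If `X` is geodesic, then `FS_n(X)` is `2`-quasiconvex: any two nonempty finite subsets
`x, y ⊆ X` of cardinality at most `n` are joined by a `2·d_H(x,y)`-Lipschitz path through
nonempty finite subsets of cardinality at most `n`. -/
theorem FSn_two_quasiconvex {X : Type*} [MetricSpace X] (hX : QuasiconvexSpace X 1)
    (n : ℕ) (hn : 1 ≤ n) (x y : Set X)
    (hxfin : x.Finite) (hxne : x.Nonempty) (hxcard : x.ncard ≤ n)
    (hyfin : y.Finite) (hyne : y.Nonempty) (hycard : y.ncard ≤ n) :
    ∃ γ : unitInterval → Set X, γ 0 = x ∧ γ 1 = y ∧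
      (∀ t : unitInterval, (γ t).Finite ∧ (γ t).Nonempty ∧ (γ t).ncard ≤ n) ∧
      ∀ s t : unitInterval,
        Metric.hausdorffDist (γ s) (γ t) ≤ 2 * Metric.hausdorffDist x y * dist s t := by
  classical
  set r := Metric.hausdorffDist x y with hrdef
  have hr : 0 ≤ r := Metric.hausdorffDist_nonneg
  obtain ⟨f, g, hfg, hf, hg⟩ := star_cover (fun a b => dist a b ≤ r) hxfin.toFinset hyfin.toFinset
    (by simpa using exists_close hxfin hxne hyfin hyne)
    (by
      have := exists_close hyfin hyne hxfin hxne
      rw [Metric.hausdorffDist_comm] at this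
      simpa [dist_comm] using this)
  simp only [Set.Finite.coe_toFinset, Set.Finite.mem_toFinset] at hfg hf hg
  obtain ⟨A, hA0, hA1, hAc, hA⟩ := moving hX x hxfin hxne f r hr (fun a ha => by
    rcases hf a ha with h | h
    · rw [h]; simpa using hr
    · exact h)
  obtain ⟨B, hB0, hB1, hBc, hB⟩ := moving hX y hyfin hyne g r hr (fun a ha => by
    rcases hg a ha with h | h
    · rw [h]; simpa using hr
    · rw [dist_comm]; exact h)
  let c : ℝ → unitInterval := Set.projIcc 0 1 zero_le_one
  have hc : ∀ u v : ℝ, dist (c u) (c v) ≤ |u - v| := by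
    intro u v
    rw [Subtype.dist_eq, Real.dist_eq]
    exact Set.abs_projIcc_sub_projIcc zero_le_one
  let A' : unitInterval → Set X := fun t => A (c (2 * t))
  let B' : unitInterval → Set X := fun t => B (c (2 - 2 * t))
  have hA' : ∀ s t, Metric.hausdorffDist (A' s) (A' t) ≤ 2 * r * dist s t := by
    intro s t
    refine (hA _ _).trans ?_
    have h := hc (2 * s) (2 * t)
    rw [← mul_sub, abs_mul, abs_two] at h
    rw [Subtype.dist_eq s t, Real.dist_eq]
    nlinarith [mul_le_mul_of_nonneg_left h hr]
  have hB' : ∀ s t, Metric.hausdorffDist (B' s) (B' t) ≤ 2 * r * dist s t := by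
    intro s t
    refine (hB _ _).trans ?_
    have h := hc (2 - 2 * s) (2 - 2 * t)
    rw [show (2 - 2 * (s:ℝ)) - (2 - 2 * t) = 2 * (t - s) by ring, abs_mul, abs_two, abs_sub_comm] at h
    rw [Subtype.dist_eq s t, Real.dist_eq]
    nlinarith [mul_le_mul_of_nonneg_left h hr]
  have hc1 : c 1 = 1 := Set.projIcc_right _
  have hc0 : c 0 = 0 := Set.projIcc_left _
  let m : unitInterval := ⟨1/2, by norm_num, by norm_num⟩
  have hm : A' m = B' m := by
    have e1 : (2 * (m : ℝ)) = 1 := by simp [m]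
    have e2 : (2 - 2 * (m : ℝ)) = 1 := by rw [e1]; norm_num
    simp only [A', B']
    rw [e2, e1, hc1, hA1, hB1, hfg]
  refine ⟨fun t => if t ≤ m then A' t else B' t, ?_, ?_, ?_, ?_⟩
  · have : (0 : unitInterval) ≤ m := m.2.1
    simp [this, A', hc0, hA0]
  · have : ¬ (1 : unitInterval) ≤ m := by
      rw [← Subtype.coe_le_coe]; norm_num [m]
    simp [this, B', hc0, hB0]
  · intro t
    by_cases h : t ≤ m
    · simp only [h, if_true]
      obtain ⟨h1, h2, h3⟩ := hAc (c (2 * t))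
      exact ⟨h1, h2, h3.trans hxcard⟩
    · simp only [h, if_false]
      obtain ⟨h1, h2, h3⟩ := hBc (c (2 - 2 * t))
      exact ⟨h1, h2, h3.trans hycard⟩
  · have cross : ∀ s t : unitInterval, s ≤ m → m ≤ t →
        Metric.hausdorffDist (A' s) (B' t) ≤ 2 * r * dist s t := by
      intro s t hs ht
      have htri : Metric.hausdorffDist (A' s) (B' t) ≤
          Metric.hausdorffDist (A' s) (A' m) + Metric.hausdorffDist (A' m) (B' t) :=
        Metric.hausdorffDist_triangle
          (Metric.hausdorffEDist_ne_top_of_nonempty_of_bounded (hAc _).2.1 (hAc _).2.1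
            (hAc _).1.isBounded (hAc _).1.isBounded)
      have h1 := hA' s m
      have h2 := hB' m t
      rw [← hm] at h2
      have h3 : dist s t = dist s m + dist m t := by
        simp only [Subtype.dist_eq, Real.dist_eq]
        have hs' : (s : ℝ) ≤ m := hs
        have ht' : (m : ℝ) ≤ t := ht
        rw [abs_of_nonpos (by linarith), abs_of_nonpos (by linarith), abs_of_nonpos (by linarith)]
        ring
      rw [h3, mul_add]
      linarith
    intro s t
    by_cases hs : s ≤ m <;> by_cases ht : t ≤ m
    · simp only [hs, ht, if_true]; exact hA' s t
    · simp only [hs, ht, if_true, if_false]; exact cross s t hs (not_le.1 ht).le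
    · simp only [hs, ht, if_true, if_false]
      rw [Metric.hausdorffDist_comm, dist_comm]
      exact cross t s ht (not_le.1 hs).le
    · simp only [hs, ht, if_false]; exact hB' s t
end

section
/- Let λ ≥ 1 and let X be a λ-quasiconvex metric space. Then: (1) for any nonempty finite subsets x, y of X with |x| ≤ 2 and |y| ≤ 2 there is a map γ : [0,1] → Set X with γ(0) = x, γ(1) = y, every γ(t) a nonempty finite subset with |γ(t)| ≤ 2, and d_H(γ(s), γ(t)) ≤ λ·d_H(x,y)·|s−t| for all s,t ∈ [0,1] (FS_2(X) is λ-quasiconvex); and (2) for every n ≥ 1 and any nonempty finite subsets x, y of X with |x| ≤ n and |y| ≤ n there is a map γ : [0,1] → Set X with γ(0) = x, γ(1) = y, every γ(t) a nonempty finite subset with |γ(t)| ≤ n, and d_H(γ(s), γ(t)) ≤ 2λ·d_H(x,y)·|s−t| for all s,t ∈ [0,1] (FS_n(X) is 2λ-quasiconvex). -/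
open unitInterval

lemma FSaux_attained {X : Type*} [MetricSpace X] {x y : Set X} (hx : x.Finite)
    (hx' : x.Nonempty) (hy : y.Finite) (hy' : y.Nonempty) :
    ∀ p ∈ x, ∃ q ∈ y, dist p q ≤ Metric.hausdorffDist x y := by
  intro p hp
  obtain ⟨q, hq, h⟩ := hy.isCompact.exists_infDist_eq_dist hy' p
  refine ⟨q, hq, ?_⟩
  rw [← h]
  exact Metric.infDist_le_hausdorffDist_of_mem hp
    (Metric.hausdorffEDist_ne_top_of_nonempty_of_bounded hx' hy' hx.isBounded hy.isBounded)

lemma FSaux_path {X : Type*} [MetricSpace X]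
    (lam : ℝ) (hlam : 1 ≤ lam) (hX : QuasiconvexSpace X lam) {ι : Type*} (S : Set ι)
    (hS : S.Finite) (hS' : S.Nonempty) (n : ℕ) (hn : S.ncard ≤ n) (f g : ι → X) (r : ℝ)
    (hr : 0 ≤ r) (h : ∀ i ∈ S, dist (f i) (g i) ≤ r) :
    ∃ γ : unitInterval → Set X, γ 0 = f '' S ∧ γ 1 = g '' S ∧
        (∀ t : unitInterval, (γ t).Finite ∧ (γ t).Nonempty ∧ (γ t).ncard ≤ n) ∧
        ∀ s t : unitInterval,
          Metric.hausdorffDist (γ s) (γ t) ≤ lam * r * dist s t := by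
  choose c _ hc0 hc1 hc using hX
  refine ⟨fun t => (fun i => c (f i) (g i) t) '' S, by simp [hc0], by simp [hc1], ?_, ?_⟩
  · intro t
    exact ⟨hS.image _, hS'.image _, (Set.ncard_image_le hS).trans hn⟩
  · intro s t
    have key : ∀ s t : unitInterval, ∀ i ∈ S,
        dist (c (f i) (g i) s) (c (f i) (g i) t) ≤ lam * r * dist s t := by
      intro s t i hi
      refine (hc _ _ s t).trans ?_
      have := h i hi
      gcongr
    apply Metric.hausdorffDist_le_of_mem_dist
    · positivity
    · rintro _ ⟨i, hi, rfl⟩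
      exact ⟨_, ⟨i, hi, rfl⟩, key s t i hi⟩
    · rintro _ ⟨i, hi, rfl⟩
      refine ⟨_, ⟨i, hi, rfl⟩, ?_⟩
      rw [dist_comm s t]
      exact key t s i hi

lemma FSaux_cover {X : Type*} {x y : Set X} (hx : x.Finite) (hy : y.Finite)
    (R : X → X → Prop) (h1 : ∀ p ∈ x, ∃ q ∈ y, R p q) (h2 : ∀ q ∈ y, ∃ p ∈ x, R p q) :
    ∃ f g : X → X, (∀ p ∈ x, f p = p ∨ R p (f p)) ∧ (∀ q ∈ y, g q = q ∨ R (g q) q) ∧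
      f '' x = g '' y := by
  classical
  let P : Set (Set (X × X)) := {E | E ⊆ x ×ˢ y ∧ (∀ e ∈ E, R e.1 e.2) ∧
    (∀ p ∈ x, ∃ q, (p, q) ∈ E) ∧ (∀ q ∈ y, ∃ p, (p, q) ∈ E)}
  have hP : P.Finite := (hx.prod hy).finite_subsets.subset (fun E hE => hE.1)
  have hP' : P.Nonempty := by
    refine ⟨{e | e ∈ x ×ˢ y ∧ R e.1 e.2}, fun e he => he.1, fun e he => he.2, ?_, ?_⟩
    · intro p hp
      obtain ⟨q, hq, h⟩ := h1 p hp
      exact ⟨q, ⟨hp, hq⟩, h⟩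
    · intro q hq
      obtain ⟨p, hp, h⟩ := h2 q hq
      exact ⟨p, ⟨hp, hq⟩, h⟩
  obtain ⟨E, hE⟩ := hP.exists_minimal hP'
  obtain ⟨hsub, hR, hpx, hqy⟩ := hE.1
  have hmin : ∀ p q, (p, q) ∈ E → (∀ q', (p, q') ∈ E → q' = q) ∨
      (∀ p', (p', q) ∈ E → p' = p) := by
    intro p q hpq
    by_contra hcon
    push Not at hcon
    obtain ⟨⟨q', hq', hqne⟩, p', hp', hpne⟩ := hcon
    have hmem : E \ {(p, q)} ∈ P := by
      refine ⟨fun e he => hsub he.1, fun e he => hR e he.1, ?_, ?_⟩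
      · intro a ha
        obtain ⟨b, hb⟩ := hpx a ha
        by_cases hab : (a, b) = (p, q)
        · obtain ⟨rfl, rfl⟩ := Prod.mk.inj hab
          exact ⟨q', hq', by simp [hqne]⟩
        · exact ⟨b, hb, hab⟩
      · intro b hb
        obtain ⟨a, ha⟩ := hqy b hb
        by_cases hab : (a, b) = (p, q)
        · obtain ⟨rfl, rfl⟩ := Prod.mk.inj hab
          exact ⟨p', hp', by simp [hpne]⟩
        · exact ⟨a, ha, hab⟩
    have := hE.2 hmem Set.sdiff_subset hpq
    exact this.2 rfl
  choose! φ hφ using hpx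
  choose! ψ hψ using hqy
  let D : X → Prop := fun p => ∀ q', (p, q') ∈ E → q' = φ p
  refine ⟨fun p => if D p then φ p else p,
    fun q => if ∃ p, (p, q) ∈ E ∧ D p then q else ψ q, ?_, ?_, ?_⟩
  · intro p hp
    by_cases h : D p
    · right; simpa [h] using hR _ (hφ p hp)
    · left; simp [h]
  · intro q hq
    by_cases h : ∃ p, (p, q) ∈ E ∧ D p
    · left; simp only [if_pos h]
    · right; simp only [if_neg h]; exact hR _ (hψ q hq)
  · apply Set.Subset.antisymm
    · rintro _ ⟨p, hp, rfl⟩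
      have hpE := hφ p hp
      refine ⟨φ p, (hsub hpE).2, ?_⟩
      by_cases h : D p
      · have : ∃ p', (p', φ p) ∈ E ∧ D p' := ⟨p, hpE, h⟩
        simp only [if_pos h, if_pos this]
      · have hu := (hmin p _ hpE).resolve_left h
        have : ¬ ∃ p', (p', φ p) ∈ E ∧ D p' := by
          rintro ⟨p', hp', hD⟩
          rw [hu p' hp'] at hD
          exact h hD
        simp only [if_neg h, if_neg this]
        exact hu _ (hψ _ (hsub hpE).2)
    · rintro _ ⟨q, hq, rfl⟩
      by_cases h : ∃ p, (p, q) ∈ E ∧ D p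
      · obtain ⟨p, hp, hD⟩ := id h
        refine ⟨p, (hsub hp).1, ?_⟩
        simp only [if_pos h, if_pos hD]
        exact (hD q hp).symm
      · have hq' := hψ q hq
        refine ⟨ψ q, (hsub hq').1, ?_⟩
        have : ¬ D (ψ q) := fun hD => h ⟨_, hq', hD⟩
        simp only [if_neg h, if_neg this]

lemma FSaux_concat {X : Type*} [MetricSpace X] (L : ℝ) (n : ℕ)
    (a b : unitInterval → Set X) (hab : a 1 = b 0)
    (ha : ∀ t, (a t).Finite ∧ (a t).Nonempty ∧ (a t).ncard ≤ n)
    (hb : ∀ t, (b t).Finite ∧ (b t).Nonempty ∧ (b t).ncard ≤ n)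
    (hLa : ∀ s t, Metric.hausdorffDist (a s) (a t) ≤ L * dist s t)
    (hLb : ∀ s t, Metric.hausdorffDist (b s) (b t) ≤ L * dist s t) :
    ∃ γ : unitInterval → Set X, γ 0 = a 0 ∧ γ 1 = b 1 ∧
        (∀ t : unitInterval, (γ t).Finite ∧ (γ t).Nonempty ∧ (γ t).ncard ≤ n) ∧
        ∀ s t : unitInterval,
          Metric.hausdorffDist (γ s) (γ t) ≤ 2 * L * dist s t := by
  let γ : unitInterval → Set X := fun t =>
    if h : (t : ℝ) ≤ 1 / 2 then a ⟨2 * t, by have := t.2.1; constructor <;> linarith⟩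
    else b ⟨2 * t - 1, by have := t.2.2; constructor <;> linarith⟩
  have hγ1 : ∀ t : unitInterval, (t : ℝ) ≤ 1 / 2 →
      ∃ u : unitInterval, (u : ℝ) = 2 * t ∧ γ t = a u := by
    intro t h
    exact ⟨⟨2 * t, by have := t.2.1; constructor <;> linarith⟩, rfl, by simp only [γ, dif_pos h]⟩
  have hγ2 : ∀ t : unitInterval, ¬ (t : ℝ) ≤ 1 / 2 →
      ∃ u : unitInterval, (u : ℝ) = 2 * t - 1 ∧ γ t = b u := by
    intro t h
    exact ⟨⟨2 * t - 1, by have := t.2.2; constructor <;> linarith⟩, rfl,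
      by simp only [γ, dif_neg h]⟩
  have cross : ∀ s t : unitInterval, (s : ℝ) ≤ 1 / 2 → ¬ (t : ℝ) ≤ 1 / 2 →
      Metric.hausdorffDist (γ s) (γ t) ≤ 2 * L * dist s t := by
    intro s t hs ht
    obtain ⟨u, hu, hu'⟩ := hγ1 s hs
    obtain ⟨v, hv, hv'⟩ := hγ2 t ht
    rw [hu', hv']
    have tri : Metric.hausdorffDist (a u) (b v) ≤
        Metric.hausdorffDist (a u) (a 1) + Metric.hausdorffDist (a 1) (b v) :=
      Metric.hausdorffDist_triangle
        (Metric.hausdorffEDist_ne_top_of_nonempty_of_bounded (ha u).2.1 (ha 1).2.1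
          (ha u).1.isBounded (ha 1).1.isBounded)
    have e1 := hLa u 1
    have e2 := hLb 0 v
    rw [hab] at tri e1
    have d1 : dist u 1 = 1 - 2 * s := by
      rw [Subtype.dist_eq, Real.dist_eq, hu, abs_sub_comm, abs_of_nonneg] <;>
        simp <;> linarith
    have d2 : dist 0 v = 2 * t - 1 := by
      rw [Subtype.dist_eq, Real.dist_eq, hv, abs_sub_comm, abs_of_nonneg] <;>
        simp <;> linarith
    have d3 : dist s t = t - s := by
      rw [Subtype.dist_eq, Real.dist_eq, abs_sub_comm, abs_of_nonneg]; linarith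
    rw [d1] at e1
    rw [d2] at e2
    rw [d3]
    linarith
  refine ⟨γ, ?_, ?_, ?_, ?_⟩
  · obtain ⟨u, hu, h⟩ := hγ1 0 (by simp)
    rw [h]; congr 1; ext; simp [hu]
  · obtain ⟨u, hu, h⟩ := hγ2 1 (by norm_num)
    rw [h]; congr 1; ext; rw [hu]; norm_num
  · intro t
    by_cases h : (t : ℝ) ≤ 1 / 2
    · obtain ⟨u, -, h⟩ := hγ1 t h
      rw [h]; exact ha u
    · obtain ⟨u, -, h⟩ := hγ2 t h
      rw [h]; exact hb u
  · intro s t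
    by_cases hs : (s : ℝ) ≤ 1 / 2 <;> by_cases ht : (t : ℝ) ≤ 1 / 2
    · obtain ⟨u, hu, hu'⟩ := hγ1 s hs
      obtain ⟨v, hv, hv'⟩ := hγ1 t ht
      rw [hu', hv']
      refine (hLa u v).trans_eq ?_
      have : dist u v = 2 * dist s t := by
        rw [Subtype.dist_eq, Subtype.dist_eq, Real.dist_eq, Real.dist_eq, hu, hv, ← mul_sub,
          abs_mul, abs_two]
      rw [this]; ring
    · exact cross s t hs ht
    · rw [Metric.hausdorffDist_comm, dist_comm]
      exact cross t s ht hs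
    · obtain ⟨u, hu, hu'⟩ := hγ2 s hs
      obtain ⟨v, hv, hv'⟩ := hγ2 t ht
      rw [hu', hv']
      refine (hLb u v).trans_eq ?_
      have : dist u v = 2 * dist s t := by
        rw [Subtype.dist_eq, Subtype.dist_eq, Real.dist_eq, Real.dist_eq, hu, hv,
          sub_sub_sub_cancel_right, ← mul_sub, abs_mul, abs_two]
      rw [this]; ring

lemma FSaux_pair {X : Type*} {x : Set X} (hx : x.Finite) (hx' : x.Nonempty)
    (h : x.ncard ≤ 2) : ∃ a b, x = {a, b} := by
  have h0 : 0 < x.ncard := (Set.ncard_pos hx).2 hx'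
  rcases (by omega : x.ncard = 1 ∨ x.ncard = 2) with h | h
  · obtain ⟨a, rfl⟩ := Set.ncard_eq_one.1 h
    exact ⟨a, a, by simp⟩
  · obtain ⟨a, b, -, rfl⟩ := Set.ncard_eq_two.1 h
    exact ⟨a, b, rfl⟩

/-- If `X` is `λ`-quasiconvex (`λ ≥ 1`), then (1) `FS_2(X)` is `λ`-quasiconvex and
(2) for every `n ≥ 1`, `FS_n(X)` is `2λ`-quasiconvex. -/
theorem FS2_and_FSn_quasiconvex {X : Type*} [MetricSpace X]
    (lam : ℝ) (hlam : 1 ≤ lam) (hX : QuasiconvexSpace X lam) :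
    (∀ x y : Set X, x.Finite → x.Nonempty → x.ncard ≤ 2 →
      y.Finite → y.Nonempty → y.ncard ≤ 2 →
      ∃ γ : unitInterval → Set X, γ 0 = x ∧ γ 1 = y ∧
        (∀ t : unitInterval, (γ t).Finite ∧ (γ t).Nonempty ∧ (γ t).ncard ≤ 2) ∧
        ∀ s t : unitInterval,
          Metric.hausdorffDist (γ s) (γ t) ≤ lam * Metric.hausdorffDist x y * dist s t) ∧
    (∀ n : ℕ, 1 ≤ n → ∀ x y : Set X, x.Finite → x.Nonempty → x.ncard ≤ n →
      y.Finite → y.Nonempty → y.ncard ≤ n →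
      ∃ γ : unitInterval → Set X, γ 0 = x ∧ γ 1 = y ∧
        (∀ t : unitInterval, (γ t).Finite ∧ (γ t).Nonempty ∧ (γ t).ncard ≤ n) ∧
        ∀ s t : unitInterval,
          Metric.hausdorffDist (γ s) (γ t) ≤ 2 * lam * Metric.hausdorffDist x y * dist s t) := by
  constructor
  · intro x y hx hx' hx2 hy hy' hy2
    have h1 := FSaux_attained hx hx' hy hy'
    have h2 := FSaux_attained hy hy' hx hx'
    rw [Metric.hausdorffDist_comm] at h2
    have hr : 0 ≤ Metric.hausdorffDist x y := Metric.hausdorffDist_nonneg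
    generalize Metric.hausdorffDist x y = r at *
    obtain ⟨a, b, rfl⟩ := FSaux_pair hx hx' hx2
    obtain ⟨c, d, rfl⟩ := FSaux_pair hy hy' hy2
    have main : ∀ c' d' : X, dist a c' ≤ r → dist b d' ≤ r →
        ∃ γ : unitInterval → Set X, γ 0 = {a, b} ∧ γ 1 = {c', d'} ∧
        (∀ t : unitInterval, (γ t).Finite ∧ (γ t).Nonempty ∧ (γ t).ncard ≤ 2) ∧
        ∀ s t : unitInterval, Metric.hausdorffDist (γ s) (γ t) ≤ lam * r * dist s t := by
      intro c' d' hac hbd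
      have := FSaux_path lam hlam hX ({true, false} : Set Bool) (Set.toFinite _) (by simp) 2
        (by rw [Set.ncard_pair (by simp)]) (fun i => if i then a else b) (fun i => if i then c' else d') r hr
        (by simp [hac, hbd])
      simpa [Set.image_pair] using this
    simp only [Set.mem_insert_iff, Set.mem_singleton_iff, forall_eq_or_imp, forall_eq,
      exists_eq_or_imp, exists_eq_left] at h1 h2
    rw [dist_comm c a, dist_comm c b, dist_comm d a, dist_comm d b] at h2
    have : (dist a c ≤ r ∧ dist b d ≤ r) ∨ (dist a d ≤ r ∧ dist b c ≤ r) := by tauto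
    rcases this with h | h
    · exact main c d h.1 h.2
    · rw [Set.pair_comm c d]
      exact main d c h.1 h.2
  · intro n _ x y hx hx' hxn hy hy' hyn
    have h1 := FSaux_attained hx hx' hy hy'
    have h2 := FSaux_attained hy hy' hx hx'
    rw [Metric.hausdorffDist_comm] at h2
    have hr : 0 ≤ Metric.hausdorffDist x y := Metric.hausdorffDist_nonneg
    generalize Metric.hausdorffDist x y = r at *
    obtain ⟨f, g, hf, hg, hfg⟩ := FSaux_cover hx hy (fun p q => dist p q ≤ r) h1
      (by simpa only [dist_comm] using h2)
    obtain ⟨α, α0, α1, hα, hLα⟩ := FSaux_path lam hlam hX x hx hx' n hxn id f r hr (by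
      intro p hp
      rcases hf p hp with h | h
      · simpa [h] using hr
      · exact h)
    obtain ⟨β, β0, β1, hβ, hLβ⟩ := FSaux_path lam hlam hX y hy hy' n hyn g id r hr (by
      intro p hp
      rcases hg p hp with h | h
      · simpa [h] using hr
      · exact h)
    obtain ⟨γ, γ0, γ1, hγ, hL⟩ := FSaux_concat (lam * r) n α β (by rw [α1, β0, hfg]) hα hβ hLα hLβ
    refine ⟨γ, by simpa [α0] using γ0, by simpa [β1] using γ1, hγ, fun s t => ?_⟩
    rw [mul_assoc 2 lam r]
    exact hL s t
end
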